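/- Let d ≥ 1, m ≥ -d, σ ∈ (0,1), and let L = -Δ + |x|² + m be the Hermite-type operator on ℝ^d. Suppose f : ℝ^d → ℝ is measurable, f ∈ L¹(Φ_σ), and f is strictly 2σ-smooth at a point x₀ ∈ ℝ^d. Then the function t ↦ P^σ_t f(x₀) is differentiable on (0,∞) and lim_{t→0⁺} ( −c_σ · t^{1−2σ} · ∂_t P^σ_t f(x₀) ) = (1/Γ(-σ)) ∫₀^∞ ( e^{-sL}f(x₀) − f(x₀) ) s^{-(1+σ)} ds, where c_σ = 2^{2σ−1} Γ(σ)/Γ(1−σ) and Γ(-σ) := Γ(1-σ)/(-σ). -/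

import Mathlib

open MeasureTheory Set Filter
open RealInnerProductSpace

/-- The Mehler heat kernel of the Hermite-type operator `L = -Δ + |x|² + m` on `ℝ^d`. -/
noncomputable def mehler (d : ℕ) (m : ℝ) (t : ℝ)
    (x y : EuclideanSpace ℝ (Fin d)) : ℝ :=
  Real.exp (-t * m) * (2 * Real.pi * Real.sinh (2 * t)) ^ (-(d : ℝ) / 2) *
    Real.exp (-‖x - y‖ ^ 2 / (2 * Real.tanh (2 * t)) - Real.tanh t * ⟪x, y⟫)

/-- The weight `Φ_σ` associated with `L = -Δ + |x|² + m`. -/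
noncomputable def PhiSigma (d : ℕ) (m σ : ℝ) (y : EuclideanSpace ℝ (Fin d)) : ℝ :=
  if m = -(d : ℝ) then
    Real.exp (-‖y‖ ^ 2 / 2) / Real.log (Real.exp 1 + ‖y‖) ^ σ
  else
    Real.exp (-‖y‖ ^ 2 / 2) /
      ((1 + ‖y‖) ^ (((d : ℝ) + m) / 2) * Real.log (Real.exp 1 + ‖y‖) ^ (1 + σ))

/-- `f` is `α`-smooth at `x₀` (`f ∈ D^α(x₀)`). -/
def DalphaAt (d : ℕ) (α : ℝ) (f : EuclideanSpace ℝ (Fin d) → ℝ)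
    (x₀ : EuclideanSpace ℝ (Fin d)) : Prop :=
  ∃ δ > (0 : ℝ), MeasureTheory.IntegrableOn
    (fun h => |f (x₀ + h) + f (x₀ - h) - 2 * f x₀| / ‖h‖ ^ ((d : ℝ) + α))
    {h : EuclideanSpace ℝ (Fin d) | ‖h‖ ≤ δ}

/-- `f` is strictly `α`-smooth at `x₀` (`f ∈ D^α_st(x₀)`). -/
def DalphaStAt (d : ℕ) (α : ℝ) (f : EuclideanSpace ℝ (Fin d) → ℝ)
    (x₀ : EuclideanSpace ℝ (Fin d)) : Prop :=
  DalphaAt d α f x₀ ∧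
  ∃ δ > (0 : ℝ), MeasureTheory.IntegrableOn
    (fun h => |f (x₀ + h) - f (x₀ - h)| / ‖h‖ ^ max ((d : ℝ) + α - 3) 0)
    {h : EuclideanSpace ℝ (Fin d) | ‖h‖ ≤ δ}

/-- The subordinated (Poisson) kernel of the Hermite-type operator. -/
noncomputable def hermitePoisson (d : ℕ) (m σ : ℝ) (t : ℝ)
    (x y : EuclideanSpace ℝ (Fin d)) : ℝ :=
  ((t / 2) ^ (2 * σ) / Real.Gamma σ) *
    ∫ s in Set.Ioi (0 : ℝ), Real.exp (-t ^ 2 / (4 * s)) * mehler d m s x y * s ^ (-(1 + σ))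

section HyperbolicBounds

theorem Real.tanh_pos_of_pos {u : ℝ} (hu : 0 < u) : 0 < Real.tanh u := by
  rw [Real.tanh_eq_sinh_div_cosh]
  exact div_pos (Real.sinh_pos_iff.mpr hu) (Real.cosh_pos u)

theorem Real.measurable_tanh' : Measurable Real.tanh := by
  have : Real.tanh = fun x => Real.sinh x / Real.cosh x :=
    funext Real.tanh_eq_sinh_div_cosh
  rw [this]
  exact Real.measurable_sinh.div Real.measurable_cosh

theorem Real.tanh_le_self {u : ℝ} (hu : 0 ≤ u) : Real.tanh u ≤ u := by
  rw [Real.tanh_eq_sinh_div_cosh, div_le_iff₀ (Real.cosh_pos u)]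
  have hmono : MonotoneOn (fun v : ℝ => v * Real.cosh v - Real.sinh v) (Set.Ici 0) := by
    have hd (v : ℝ) : HasDerivAt (fun v : ℝ => v * Real.cosh v - Real.sinh v)
        (v * Real.sinh v) v :=
      (((hasDerivAt_id' v).mul (Real.hasDerivAt_cosh v)).sub
        (Real.hasDerivAt_sinh v)).congr_deriv (by ring)
    refine monotoneOn_of_deriv_nonneg (convex_Ici 0)
      (fun v _ => (hd v).continuousAt.continuousWithinAt)
      (fun v _ => (hd v).differentiableAt.differentiableWithinAt) fun v hv => ?_
    rw [(hd v).deriv]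
    rw [interior_Ici] at hv
    exact mul_nonneg (le_of_lt hv) (Real.sinh_nonneg_iff.mpr (le_of_lt hv))
  have := hmono (Set.mem_Ici.mpr le_rfl) (Set.mem_Ici.mpr hu) hu
  simp at this
  linarith

theorem Real.tanh_eq_one_sub (u : ℝ) : Real.tanh u = 1 - 2 / (Real.exp (2 * u) + 1) := by
  rw [Real.tanh_eq_sinh_div_cosh, Real.sinh_eq, Real.cosh_eq, Real.exp_neg,
    two_mul u, Real.exp_add]
  have := Real.exp_pos u
  field_simp
  ring

theorem Real.tanh_le_tanh {u v : ℝ} (huv : u ≤ v) : Real.tanh u ≤ Real.tanh v := by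
  rw [Real.tanh_eq_one_sub, Real.tanh_eq_one_sub]
  gcongr

/-- `coth u ≥ 1 + 2 e^{-2u}`. -/
theorem Real.one_add_two_mul_exp_le_inv_tanh {u : ℝ} (hu : 0 < u) :
    1 + 2 * Real.exp (-(2 * u)) ≤ (Real.tanh u)⁻¹ := by
  have hpos := Real.tanh_pos_of_pos hu
  rw [le_inv_comm₀ (by positivity) hpos, Real.tanh_eq_one_sub, Real.exp_neg]
  have h := Real.exp_pos (2 * u)
  set w := Real.exp (2 * u)
  rw [← one_div, le_div_iff₀ (by positivity)]
  have : (1 - 2 / (w + 1)) * (1 + 2 * w⁻¹) = 1 - 2 / (w * (w + 1)) := by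
    field_simp
    ring
  have : 0 < 2 / (w * (w + 1)) := by positivity
  linarith

theorem Real.exp_le_four_mul_sinh {u : ℝ} (hu : 1 ≤ u) : Real.exp u ≤ 4 * Real.sinh u := by
  rw [Real.sinh_eq, Real.exp_neg]
  have h1 : (2 : ℝ) ≤ Real.exp u := by have := Real.add_one_le_exp u; linarith
  have : (Real.exp u)⁻¹ ≤ (2 : ℝ)⁻¹ := by gcongr
  linarith

end HyperbolicBounds

section MehlerBasics

variable {d : ℕ} {m : ℝ}

theorem mehler_nonneg {s : ℝ} (hs : 0 ≤ s) (x y : EuclideanSpace ℝ (Fin d)) :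
    0 ≤ mehler d m s x y := by
  unfold mehler
  have : 0 ≤ Real.sinh (2 * s) := Real.sinh_nonneg_iff.mpr (by linarith)
  positivity

theorem measurable_mehler (d : ℕ) (m : ℝ) (x : EuclideanSpace ℝ (Fin d)) :
    Measurable (fun p : ℝ × EuclideanSpace ℝ (Fin d) => mehler d m p.1 x p.2) := by
  unfold mehler
  have h1 : Measurable fun p : ℝ × EuclideanSpace ℝ (Fin d) => Real.tanh (2 * p.1) :=
    Real.measurable_tanh'.comp (by fun_prop)
  have h2 : Measurable fun p : ℝ × EuclideanSpace ℝ (Fin d) => Real.tanh p.1 :=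
    Real.measurable_tanh'.comp (by fun_prop)
  have h3 : Measurable fun p : ℝ × EuclideanSpace ℝ (Fin d) => Real.sinh (2 * p.1) :=
    Real.measurable_sinh.comp (by fun_prop)
  have h4 : Measurable fun p : ℝ × EuclideanSpace ℝ (Fin d) => ⟪x, p.2⟫ :=
    (by fun_prop : Continuous fun p : ℝ × EuclideanSpace ℝ (Fin d) => ⟪x, p.2⟫).measurable
  fun_prop

/-- The Mehler exponent with the cross term over `sinh`. -/
theorem mehler_exponent_eq {s : ℝ} (hs : 0 < s) (x y : EuclideanSpace ℝ (Fin d)) :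
    -‖x - y‖ ^ 2 / (2 * Real.tanh (2 * s)) - Real.tanh s * ⟪x, y⟫ =
      -(‖x‖ ^ 2 + ‖y‖ ^ 2) * (Real.tanh (2 * s))⁻¹ / 2 + ⟪x, y⟫ / Real.sinh (2 * s) := by
  have hS : 0 < Real.sinh s := Real.sinh_pos_iff.mpr hs
  have hC : 0 < Real.cosh s := Real.cosh_pos s
  have hC2 : 0 < Real.cosh (2 * s) := Real.cosh_pos _
  have hkey : (Real.tanh (2 * s))⁻¹ - Real.tanh s = 1 / Real.sinh (2 * s) := by
    rw [Real.tanh_eq_sinh_div_cosh, Real.tanh_eq_sinh_div_cosh, Real.sinh_two_mul, Real.cosh_two_mul]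
    rw [Real.cosh_two_mul] at hC2
    have := Real.cosh_sq s
    field_simp
    nlinarith
  rw [norm_sub_sq_real]
  have e : ⟪x, y⟫ / Real.sinh (2 * s) = ⟪x, y⟫ * ((Real.tanh (2 * s))⁻¹ - Real.tanh s) := by
    rw [hkey]; ring
  rw [e]
  have hT := (Real.tanh_pos_of_pos (show 0 < 2 * s by linarith)).ne'
  field_simp
  ring

theorem PhiSigma_eq_div {σ : ℝ} (y : EuclideanSpace ℝ (Fin d)) :
    PhiSigma d m σ y = Real.exp (-‖y‖ ^ 2 / 2) /
      (if m = -(d : ℝ) then Real.log (Real.exp 1 + ‖y‖) ^ σ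
        else (1 + ‖y‖) ^ (((d : ℝ) + m) / 2) * Real.log (Real.exp 1 + ‖y‖) ^ (1 + σ)) := by
  unfold PhiSigma
  split_ifs <;> rfl

theorem one_le_log_exp_one_add {r : ℝ} (hr : 0 ≤ r) : 1 ≤ Real.log (Real.exp 1 + r) := by
  rw [Real.le_log_iff_exp_le (by positivity)]
  linarith

theorem log_exp_one_add_le {r : ℝ} (hr : 0 ≤ r) :
    Real.log (Real.exp 1 + r) ≤ 1 + Real.log (1 + r) := by
  have h : Real.exp 1 + r ≤ Real.exp 1 * (1 + r) := by
    have : (1 : ℝ) ≤ Real.exp 1 := Real.one_le_exp (by norm_num)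
    nlinarith
  calc Real.log (Real.exp 1 + r) ≤ Real.log (Real.exp 1 * (1 + r)) :=
        Real.log_le_log (by positivity) h
    _ = 1 + Real.log (1 + r) := by
        rw [Real.log_mul (Real.exp_pos 1).ne' (by positivity), Real.log_exp]

theorem PhiSigma_pos {σ : ℝ} (y : EuclideanSpace ℝ (Fin d)) : 0 < PhiSigma d m σ y := by
  have hl : 0 < Real.log (Real.exp 1 + ‖y‖) :=
    zero_lt_one.trans_le (one_le_log_exp_one_add (norm_nonneg y))
  rw [PhiSigma_eq_div]
  split_ifs <;> positivity

theorem PhiSigma_le_exp {σ : ℝ} (hσ : 0 ≤ σ) (hm : -(d : ℝ) ≤ m)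
    (y : EuclideanSpace ℝ (Fin d)) : PhiSigma d m σ y ≤ Real.exp (-‖y‖ ^ 2 / 2) := by
  have hl := one_le_log_exp_one_add (norm_nonneg y)
  rw [PhiSigma_eq_div]
  refine div_le_self (Real.exp_pos _).le ?_
  split_ifs with h
  · exact Real.one_le_rpow hl hσ
  · refine one_le_mul_of_one_le_of_one_le (Real.one_le_rpow ?_ ?_)
      (Real.one_le_rpow hl (by linarith))
    · linarith [norm_nonneg y]
    · linarith

theorem exists_exp_le_PhiSigma {σ : ℝ} (hσ : 0 ≤ σ) (hm : -(d : ℝ) ≤ m) {η : ℝ} (hη : 0 < η) :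
    ∃ C > 0, ∀ y : EuclideanSpace ℝ (Fin d),
      Real.exp (-‖y‖ ^ 2 / 2 - η * ‖y‖ ^ 2) ≤ C * PhiSigma d m σ y := by
  obtain ⟨N, hN0, hN⟩ : ∃ N : ℝ, 0 ≤ N ∧ ∀ y : EuclideanSpace ℝ (Fin d),
      (if m = -(d : ℝ) then Real.log (Real.exp 1 + ‖y‖) ^ σ
        else (1 + ‖y‖) ^ (((d : ℝ) + m) / 2) * Real.log (Real.exp 1 + ‖y‖) ^ (1 + σ)) ≤
      Real.exp (N * ‖y‖) := by
    have hlog (r : ℝ) (hr : 0 ≤ r) : Real.log (Real.exp 1 + r) ≤ Real.exp r := by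
      have := log_exp_one_add_le hr
      have h2 := Real.log_le_sub_one_of_pos (show 0 < 1 + r by linarith)
      have h3 := Real.add_one_le_exp r
      linarith
    have hpow (r p : ℝ) (hr : 0 ≤ r) (hp : 0 ≤ p) :
        Real.log (Real.exp 1 + r) ^ p ≤ Real.exp (p * r) := by
      have hl := one_le_log_exp_one_add hr
      rw [mul_comm, Real.exp_mul]
      exact Real.rpow_le_rpow (by linarith) (hlog r hr) hp
    refine ⟨((d : ℝ) + m) / 2 + (1 + σ), by linarith, fun y => ?_⟩
    have hr := norm_nonneg y
    have hl := one_le_log_exp_one_add hr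
    split_ifs with h
    · refine (hpow _ _ hr hσ).trans (Real.exp_le_exp.mpr ?_)
      gcongr
      linarith
    · have h1 : (1 + ‖y‖) ^ (((d : ℝ) + m) / 2) ≤ Real.exp (((d : ℝ) + m) / 2 * ‖y‖) := by
        rw [mul_comm, Real.exp_mul]
        refine Real.rpow_le_rpow (by linarith) ?_ (by linarith)
        linarith [Real.add_one_le_exp ‖y‖]
      rw [add_mul, Real.exp_add]
      have := hpow ‖y‖ (1 + σ) hr (by linarith)
      gcongr
  refine ⟨Real.exp (N ^ 2 / (4 * η)), Real.exp_pos _, fun y => ?_⟩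
  have hpos := PhiSigma_pos (m := m) (σ := σ) y
  have hN' := hN y
  rw [PhiSigma_eq_div] at hpos ⊢
  set W := (if m = -(d : ℝ) then Real.log (Real.exp 1 + ‖y‖) ^ σ
        else (1 + ‖y‖) ^ (((d : ℝ) + m) / 2) * Real.log (Real.exp 1 + ‖y‖) ^ (1 + σ))
  have hW : 0 < W := by
    rcases div_pos_iff.mp hpos with h | h
    · exact h.2
    · exact absurd h.1 (not_lt.mpr (Real.exp_pos _).le)
  rw [← mul_div_assoc, le_div_iff₀ hW]
  calc Real.exp (-‖y‖ ^ 2 / 2 - η * ‖y‖ ^ 2) * W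
      ≤ Real.exp (-‖y‖ ^ 2 / 2 - η * ‖y‖ ^ 2) * Real.exp (N * ‖y‖) := by gcongr
    _ ≤ Real.exp (N ^ 2 / (4 * η)) * Real.exp (-‖y‖ ^ 2 / 2) := by
      rw [← Real.exp_add, ← Real.exp_add, Real.exp_le_exp]
      have : N * ‖y‖ ≤ N ^ 2 / (4 * η) + η * ‖y‖ ^ 2 := by
        rw [← sub_nonneg]
        have : N ^ 2 / (4 * η) + η * ‖y‖ ^ 2 - N * ‖y‖ = (N - 2 * η * ‖y‖) ^ 2 / (4 * η) := by
          field_simp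
          ring
        rw [this]; positivity
      linarith

theorem measurable_PhiSigma (d : ℕ) (m σ : ℝ) : Measurable (PhiSigma d m σ) := by
  unfold PhiSigma
  split_ifs <;> fun_prop

theorem integrable_PhiSigma {σ : ℝ} (hσ : 0 ≤ σ) (hm : -(d : ℝ) ≤ m) :
    Integrable (PhiSigma d m σ) := by
  have h : Integrable fun y : EuclideanSpace ℝ (Fin d) => Real.exp (-(1 / 2) * ‖y‖ ^ 2) := by
    have := (GaussianFourier.integrable_cexp_neg_mul_sq_norm_add (b := (1 / 2 : ℂ))
      (by norm_num) 0 (0 : EuclideanSpace ℝ (Fin d))).norm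
    refine this.congr (Eventually.of_forall fun y => ?_)
    simp [Complex.norm_exp, ← Complex.ofReal_pow]
  refine h.mono' (measurable_PhiSigma d m σ).aestronglyMeasurable (Eventually.of_forall fun y => ?_)
  rw [Real.norm_of_nonneg (PhiSigma_pos y).le]
  refine (PhiSigma_le_exp hσ hm y).trans_eq ?_
  ring_nf

end MehlerBasics

section SmallTime

variable {d : ℕ} {m : ℝ}

theorem mehler_prefactor_le {s : ℝ} (hs : 0 < s) (hs1 : s ≤ 1) :
    Real.exp (-s * m) * (2 * Real.pi * Real.sinh (2 * s)) ^ (-(d : ℝ) / 2) ≤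
      Real.exp |m| * s ^ (-(d : ℝ) / 2) := by
  have hsinh := Real.self_le_sinh_iff.mpr (show 0 ≤ 2 * s by linarith)
  have hpi := Real.pi_gt_three
  have h1 : s ≤ 2 * Real.pi * Real.sinh (2 * s) := by nlinarith
  have h2 : -s * m ≤ |m| := by
    have := neg_abs_le m
    have := abs_nonneg m
    nlinarith
  have hd : -(d : ℝ) / 2 ≤ 0 := by
    have : (0 : ℝ) ≤ d := Nat.cast_nonneg d
    linarith
  have h3 := Real.rpow_le_rpow_of_nonpos hs h1 hd
  gcongr

theorem inv_two_mul_le_inv_tanh {s : ℝ} (hs : 0 < s) : (2 * s)⁻¹ ≤ (Real.tanh (2 * s))⁻¹ :=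
  inv_anti₀ (Real.tanh_pos_of_pos (by linarith)) (Real.tanh_le_self (by linarith))

/-- Small-time Gaussian bound for the Mehler kernel, with the decay of `PhiSigma` at infinity. -/
theorem exists_mehler_le_of_le_one {σ : ℝ} (hσ : 0 ≤ σ) (hm : -(d : ℝ) ≤ m)
    (x : EuclideanSpace ℝ (Fin d)) :
    ∃ C > 0, ∃ c > 0, ∀ s : ℝ, 0 < s → s ≤ 1 → ∀ y : EuclideanSpace ℝ (Fin d),
      mehler d m s x y ≤
        C * s ^ (-(d : ℝ) / 2) * Real.exp (-(c * ‖x - y‖ ^ 2) / s) * PhiSigma d m σ y := by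
  set k₀ := (Real.tanh 2)⁻¹ with hk₀
  have hk₀1 : 1 < k₀ :=
    (one_lt_inv₀ (Real.tanh_pos_of_pos two_pos)).mpr (Real.tanh_lt_one 2)
  set η := (k₀ - 1) / 2 with hη
  have hηpos : 0 < η := by linarith
  set θ := η / k₀ with hθ
  have hθpos : 0 < θ := by positivity
  have hθ1 : θ ≤ 1 := by
    rw [hθ, div_le_one (by linarith)]
    linarith
  have hθk : (1 - θ) * k₀ = 1 + η := by
    rw [hθ]
    field_simp
    linarith
  obtain ⟨C₀, hC₀, hPhi⟩ := exists_exp_le_PhiSigma (d := d) (m := m) hσ hm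
    (show 0 < η / 4 by positivity)
  set K := (2 + η) ^ 2 * ‖x‖ ^ 2 / η
  refine ⟨Real.exp |m| * Real.exp K * C₀, by positivity, θ / 4, by positivity,
    fun s hs hs1 y => ?_⟩
  have hcoth : 1 + η + θ * (2 * s)⁻¹ ≤ (Real.tanh (2 * s))⁻¹ := by
    have h1 := inv_two_mul_le_inv_tanh hs
    have h2 : k₀ ≤ (Real.tanh (2 * s))⁻¹ :=
      inv_anti₀ (Real.tanh_pos_of_pos (by linarith)) (Real.tanh_le_tanh (by linarith))
    nlinarith
  have hb0 : 0 ≤ Real.tanh s := (Real.tanh_pos_of_pos hs).le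
  have hb1 : Real.tanh s ≤ 1 := (Real.tanh_lt_one s).le
  have hcross : -(Real.tanh s * ⟪x, y⟫) ≤ ‖x‖ * ‖y‖ := by
    have h := abs_real_inner_le_norm x y
    have h' := neg_abs_le (⟪x, y⟫ : ℝ)
    have : 0 ≤ ‖x‖ * ‖y‖ := by positivity
    nlinarith
  have hsq : ‖y‖ ^ 2 - 2 * (‖x‖ * ‖y‖) ≤ ‖x - y‖ ^ 2 := by
    rw [norm_sub_sq_real]
    nlinarith [real_inner_le_norm x y, sq_nonneg ‖x‖]
  have hyoung : (2 + η) * (‖x‖ * ‖y‖) ≤ η / 4 * ‖y‖ ^ 2 + K := by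
    have : η / 4 * ‖y‖ ^ 2 + K - (2 + η) * (‖x‖ * ‖y‖) =
        (η * ‖y‖ - 2 * ((2 + η) * ‖x‖)) ^ 2 / (4 * η) := by
      simp only [K]
      field_simp
      ring
    have h0 : 0 ≤ (η * ‖y‖ - 2 * ((2 + η) * ‖x‖)) ^ 2 / (4 * η) := by positivity
    linarith
  have hexp : -‖x - y‖ ^ 2 / (2 * Real.tanh (2 * s)) - Real.tanh s * ⟪x, y⟫ ≤
      K + -(θ / 4 * ‖x - y‖ ^ 2) / s + (-‖y‖ ^ 2 / 2 - η / 4 * ‖y‖ ^ 2) := by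
    have e1 : -‖x - y‖ ^ 2 / (2 * Real.tanh (2 * s)) =
        -(‖x - y‖ ^ 2 * (Real.tanh (2 * s))⁻¹ / 2) := by
      rw [div_eq_mul_inv, mul_inv]; ring
    have e2 : -(θ / 4 * ‖x - y‖ ^ 2) / s = -(‖x - y‖ ^ 2 * (θ * (2 * s)⁻¹) / 2) := by
      rw [div_eq_mul_inv, mul_inv]; ring
    have h := mul_le_mul_of_nonneg_left hcoth (sq_nonneg ‖x - y‖)
    rw [e1, e2]
    nlinarith
  calc mehler d m s x y
      ≤ Real.exp |m| * s ^ (-(d : ℝ) / 2) *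
        Real.exp (K + -(θ / 4 * ‖x - y‖ ^ 2) / s + (-‖y‖ ^ 2 / 2 - η / 4 * ‖y‖ ^ 2)) := by
        unfold mehler
        have := mehler_prefactor_le (d := d) (m := m) hs hs1
        gcongr
    _ = Real.exp |m| * s ^ (-(d : ℝ) / 2) * Real.exp K * Real.exp (-(θ / 4 * ‖x - y‖ ^ 2) / s) *
        Real.exp (-‖y‖ ^ 2 / 2 - η / 4 * ‖y‖ ^ 2) := by
        rw [Real.exp_add, Real.exp_add]; ring
    _ ≤ Real.exp |m| * s ^ (-(d : ℝ) / 2) * Real.exp K * Real.exp (-(θ / 4 * ‖x - y‖ ^ 2) / s) *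
        (C₀ * PhiSigma d m σ y) := by
        have := hPhi y
        gcongr
    _ = _ := by ring

theorem mehler_add_eq (s : ℝ) (x h : EuclideanSpace ℝ (Fin d)) :
    mehler d m s x (x + h) =
      Real.exp (-s * m) * (2 * Real.pi * Real.sinh (2 * s)) ^ (-(d : ℝ) / 2) *
        Real.exp (-(Real.tanh s * ‖x‖ ^ 2)) *
        Real.exp (-(2 * Real.tanh (2 * s))⁻¹ * ‖h‖ ^ 2 + -Real.tanh s * ⟪x, h⟫) := by
  unfold mehler
  rw [mul_assoc _ (Real.exp (-(Real.tanh s * ‖x‖ ^ 2))), ← Real.exp_add]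
  congr 2
  rw [sub_add_cancel_left, norm_neg, inner_add_right, real_inner_self_eq_norm_sq]
  ring

theorem exists_mehler_near_le (m : ℝ) (x : EuclideanSpace ℝ (Fin d)) :
    ∃ C > 0, ∀ s : ℝ, 0 < s → s ≤ 1 → ∀ h : EuclideanSpace ℝ (Fin d), ‖h‖ ≤ 1 →
      mehler d m s x (x + h) ≤ C * s ^ (-(d : ℝ) / 2) * Real.exp (-(‖h‖ ^ 2 / 4) / s) ∧
      |mehler d m s x (x + h) - mehler d m s x (x + -h)| ≤
        C * s ^ (-(d : ℝ) / 2) * Real.exp (-(‖h‖ ^ 2 / 4) / s) * (s * ‖h‖) := by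
  refine ⟨Real.exp |m| * Real.exp ‖x‖ * (1 + 2 * ‖x‖), by positivity, fun s hs hs1 h hh => ?_⟩
  set P := Real.exp (-s * m) * (2 * Real.pi * Real.sinh (2 * s)) ^ (-(d : ℝ) / 2) *
        Real.exp (-(Real.tanh s * ‖x‖ ^ 2)) *
        Real.exp (-(2 * Real.tanh (2 * s))⁻¹ * ‖h‖ ^ 2) with hP
  set u := -Real.tanh s * ⟪x, h⟫ with hu
  have hb0 : 0 ≤ Real.tanh s := (Real.tanh_pos_of_pos hs).le
  have hb1 : Real.tanh s ≤ s := Real.tanh_le_self hs.le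
  have hsh : 0 ≤ Real.sinh (2 * s) := Real.sinh_nonneg_iff.mpr (by linarith)
  have hP0 : 0 ≤ P := by positivity
  have e1 : mehler d m s x (x + h) = P * Real.exp u := by
    rw [mehler_add_eq, Real.exp_add]; ring
  have e2 : mehler d m s x (x + -h) = P * Real.exp (-u) := by
    rw [mehler_add_eq, Real.exp_add, norm_neg, inner_neg_right, hP, hu]; ring_nf
  have hPle : P ≤ Real.exp |m| * s ^ (-(d : ℝ) / 2) * Real.exp (-(‖h‖ ^ 2 / 4) / s) := by
    have h1 := mehler_prefactor_le (d := d) (m := m) hs hs1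
    have h2 : Real.exp (-(Real.tanh s * ‖x‖ ^ 2)) ≤ 1 := by
      rw [Real.exp_le_one_iff]
      have : 0 ≤ Real.tanh s * ‖x‖ ^ 2 := by positivity
      linarith
    have h3 : -(2 * Real.tanh (2 * s))⁻¹ * ‖h‖ ^ 2 ≤ -(‖h‖ ^ 2 / 4) / s := by
      have := mul_le_mul_of_nonneg_left (inv_two_mul_le_inv_tanh hs) (sq_nonneg ‖h‖)
      rw [mul_inv] at this
      rw [mul_inv, div_eq_mul_inv]
      nlinarith
    calc P ≤ Real.exp |m| * s ^ (-(d : ℝ) / 2) * 1 * Real.exp (-(‖h‖ ^ 2 / 4) / s) := by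
          rw [hP]; gcongr
      _ = _ := by ring
  have huabs : |u| ≤ s * ‖h‖ * ‖x‖ := by
    rw [hu, abs_mul, abs_neg, abs_of_nonneg hb0]
    calc Real.tanh s * |⟪x, h⟫| ≤ s * (‖x‖ * ‖h‖) := by
          gcongr
          exact abs_real_inner_le_norm x h
      _ = _ := by ring
  have hu1 : |u| ≤ ‖x‖ := by
    have : s * ‖h‖ ≤ 1 := mul_le_one₀ hs1 (norm_nonneg h) hh
    have := mul_le_mul_of_nonneg_right this (norm_nonneg x)
    linarith
  have hexp : Real.exp |u| ≤ Real.exp ‖x‖ := Real.exp_le_exp.mpr hu1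
  have hx := norm_nonneg x
  constructor
  · rw [e1]
    calc P * Real.exp u ≤ (Real.exp |m| * s ^ (-(d : ℝ) / 2) * Real.exp (-(‖h‖ ^ 2 / 4) / s)) *
          Real.exp ‖x‖ := by
          have := (Real.exp_le_exp.mpr (le_abs_self u)).trans hexp
          gcongr
      _ = Real.exp |m| * Real.exp ‖x‖ * 1 * s ^ (-(d : ℝ) / 2) *
          Real.exp (-(‖h‖ ^ 2 / 4) / s) := by ring
      _ ≤ _ := by
          gcongr
          linarith
  · rw [e1, e2, ← mul_sub, abs_mul, abs_of_nonneg hP0]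
    have hdiff : |Real.exp u - Real.exp (-u)| ≤ 2 * |u| * Real.exp |u| := by
      have key (v : ℝ) (hv : 0 ≤ v) : |Real.exp v - Real.exp (-v)| ≤ 2 * v * Real.exp v := by
        have h1 : Real.exp (-v) ≤ Real.exp v := Real.exp_le_exp.mpr (by linarith)
        rw [abs_of_nonneg (by linarith)]
        have h2 := Real.add_one_le_exp (-(2 * v))
        have h3 : Real.exp (-v) = Real.exp v * Real.exp (-(2 * v)) := by
          rw [← Real.exp_add]; ring_nf
        rw [h3]
        nlinarith [Real.exp_pos v]
      rcases le_total 0 u with h0 | h0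
      · rw [abs_of_nonneg h0]; exact key u h0
      · rw [abs_of_nonpos h0, abs_sub_comm]
        simpa only [neg_neg] using key (-u) (by linarith)
    calc P * |Real.exp u - Real.exp (-u)|
        ≤ (Real.exp |m| * s ^ (-(d : ℝ) / 2) * Real.exp (-(‖h‖ ^ 2 / 4) / s)) *
          (2 * (s * ‖h‖ * ‖x‖) * Real.exp ‖x‖) := by
          refine mul_le_mul hPle (hdiff.trans ?_) (abs_nonneg _) (by positivity)
          gcongr
      _ = Real.exp |m| * Real.exp ‖x‖ * (2 * ‖x‖) * s ^ (-(d : ℝ) / 2) *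
          Real.exp (-(‖h‖ ^ 2 / 4) / s) * (s * ‖h‖) := by ring
      _ ≤ _ := by
          gcongr
          linarith

theorem integral_rexp_neg_mul_sq_norm_add {V : Type*} [NormedAddCommGroup V]
    [InnerProductSpace ℝ V] [FiniteDimensional ℝ V] [MeasurableSpace V] [BorelSpace V]
    {b : ℝ} (hb : 0 < b) (c : ℝ) (w : V) :
    ∫ v : V, Real.exp (-b * ‖v‖ ^ 2 + c * ⟪w, v⟫) =
      (Real.pi / b) ^ ((Module.finrank ℝ V : ℝ) / 2) * Real.exp (c ^ 2 * ‖w‖ ^ 2 / (4 * b)) := by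
  apply Complex.ofReal_injective
  rw [← integral_complex_ofReal]
  have h := GaussianFourier.integral_cexp_neg_mul_sq_norm_add (b := (b : ℂ)) (V := V)
    (by simpa using hb) (c : ℂ) w
  push_cast
  rw [h, Complex.ofReal_cpow (by positivity)]
  push_cast
  rfl

/-- The total mass of the Mehler kernel tends to `1` at least linearly in time. -/
theorem exists_integral_mehler_sub_one_le (m : ℝ) (x : EuclideanSpace ℝ (Fin d)) :
    ∃ C, ∀ s : ℝ, 0 < s → s ≤ 1 → |(∫ y, mehler d m s x y) - 1| ≤ C * s := by
  set K := |m| + d + ‖x‖ ^ 2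
  refine ⟨K * Real.exp K, fun s hs hs1 => ?_⟩
  have h2s : 0 < 2 * s := by linarith
  have hT := Real.tanh_pos_of_pos h2s
  have hT1 := Real.tanh_lt_one (2 * s)
  have hS : 0 < Real.sinh (2 * s) := Real.sinh_pos_iff.mpr h2s
  have hC := Real.cosh_pos (2 * s)
  have hb0 : 0 ≤ Real.tanh s := (Real.tanh_pos_of_pos hs).le
  have hb1 : Real.tanh s ≤ s := Real.tanh_le_self hs.le
  set φ := -s * m + Real.log (Real.cosh (2 * s)) * (-(d : ℝ) / 2) +
    (-(Real.tanh s * ‖x‖ ^ 2) + Real.tanh s ^ 2 * ‖x‖ ^ 2 * Real.tanh (2 * s) / 2) with hφ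
  have hmass : ∫ y, mehler d m s x y = Real.exp φ := by
    rw [← integral_add_left_eq_self (fun y => mehler d m s x y) x]
    simp_rw [mehler_add_eq]
    rw [integral_const_mul, integral_rexp_neg_mul_sq_norm_add (by positivity),
      finrank_euclideanSpace, Fintype.card_fin]
    have e1 : (Real.pi / (2 * Real.tanh (2 * s))⁻¹) ^ ((d : ℝ) / 2) =
        (2 * Real.pi * Real.sinh (2 * s)) ^ ((d : ℝ) / 2) *
          Real.cosh (2 * s) ^ (-(d : ℝ) / 2) := by
      rw [neg_div, Real.rpow_neg hC.le, ← Real.inv_rpow hC.le,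
        ← Real.mul_rpow (by positivity) (by positivity)]
      congr 1
      rw [Real.tanh_eq_sinh_div_cosh]
      field_simp
    have e2 : (2 * Real.pi * Real.sinh (2 * s)) ^ (-(d : ℝ) / 2) *
        (2 * Real.pi * Real.sinh (2 * s)) ^ ((d : ℝ) / 2) = 1 := by
      rw [← Real.rpow_add (by positivity)]
      simp [neg_div]
    have e3 : Real.cosh (2 * s) ^ (-(d : ℝ) / 2) =
        Real.exp (Real.log (Real.cosh (2 * s)) * (-(d : ℝ) / 2)) := Real.rpow_def_of_pos hC _
    have e4 : (-Real.tanh s) ^ 2 * ‖x‖ ^ 2 / (4 * (2 * Real.tanh (2 * s))⁻¹) =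
        Real.tanh s ^ 2 * ‖x‖ ^ 2 * Real.tanh (2 * s) / 2 := by
      field_simp
      ring
    rw [e1, e4, e3, hφ, Real.exp_add, Real.exp_add, Real.exp_add]
    linear_combination (Real.exp (-s * m) *
      Real.exp (Real.log (Real.cosh (2 * s)) * (-(d : ℝ) / 2)) *
      Real.exp (-(Real.tanh s * ‖x‖ ^ 2)) *
      Real.exp (Real.tanh s ^ 2 * ‖x‖ ^ 2 * Real.tanh (2 * s) / 2)) * e2
  have hφabs : |φ| ≤ K * s := by
    have h1 : |-s * m| ≤ |m| * s := by
      rw [abs_mul, abs_neg, abs_of_pos hs, mul_comm]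
    have hlog0 : 0 ≤ Real.log (Real.cosh (2 * s)) := Real.log_nonneg (Real.one_le_cosh _)
    have hlog1 : Real.log (Real.cosh (2 * s)) ≤ 2 * s := by
      rw [Real.log_le_iff_le_exp hC, Real.cosh_eq]
      have : Real.exp (-(2 * s)) ≤ Real.exp (2 * s) := Real.exp_le_exp.mpr (by linarith)
      linarith
    have h2 : |Real.log (Real.cosh (2 * s)) * (-(d : ℝ) / 2)| ≤ d * s := by
      have hd : (0 : ℝ) ≤ d := Nat.cast_nonneg d
      rw [abs_mul, neg_div, abs_neg, abs_of_nonneg hlog0, abs_of_nonneg (by positivity)]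
      nlinarith
    have h3 : |-(Real.tanh s * ‖x‖ ^ 2) + Real.tanh s ^ 2 * ‖x‖ ^ 2 * Real.tanh (2 * s) / 2|
        ≤ ‖x‖ ^ 2 * s := by
      have hx := sq_nonneg ‖x‖
      have hbx : 0 ≤ Real.tanh s * ‖x‖ ^ 2 := by positivity
      have hbT : 0 ≤ Real.tanh s * Real.tanh (2 * s) := by positivity
      have hbT1 : Real.tanh s * Real.tanh (2 * s) ≤ 1 :=
        mul_le_one₀ (by linarith) hT.le hT1.le
      have e : -(Real.tanh s * ‖x‖ ^ 2) + Real.tanh s ^ 2 * ‖x‖ ^ 2 * Real.tanh (2 * s) / 2 =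
        -((Real.tanh s * ‖x‖ ^ 2) * (1 - Real.tanh s * Real.tanh (2 * s) / 2)) := by ring
      rw [e, abs_neg, abs_of_nonneg (mul_nonneg hbx (by linarith))]
      calc _ ≤ (Real.tanh s * ‖x‖ ^ 2) * 1 := by gcongr; linarith
        _ ≤ _ := by rw [mul_one, mul_comm]; gcongr
    calc |φ| ≤ _ := abs_add_three _ _ _
      _ ≤ K * s := by
        simp only [K]
        linarith
  have hexp : |Real.exp φ - 1| ≤ |φ| * Real.exp |φ| := by
    rcases le_total 0 φ with h0 | h0
    · have h1 := Real.one_le_exp h0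
      rw [abs_of_nonneg (by linarith), abs_of_nonneg h0]
      have h2 := Real.add_one_le_exp (-φ)
      have h3 : Real.exp φ * Real.exp (-φ) = 1 := by rw [← Real.exp_add]; simp
      nlinarith [Real.exp_pos φ]
    · have h1 := Real.exp_le_one_iff.mpr h0
      rw [abs_of_nonpos (by linarith)]
      have h2 := Real.add_one_le_exp φ
      have h3 := Real.one_le_exp (abs_nonneg φ)
      have h4 := abs_of_nonpos h0
      nlinarith [abs_nonneg φ]
  have hK : 0 ≤ K := by positivity
  rw [hmass]
  calc _ ≤ |φ| * Real.exp |φ| := hexp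
    _ ≤ (K * s) * Real.exp K := by
        have : |φ| ≤ K := hφabs.trans (mul_le_of_le_one_right hK hs1)
        gcongr
    _ = _ := by ring

end SmallTime

section LargeTime

variable {d : ℕ} {m : ℝ}

theorem mehler_le_of_one_le {s : ℝ} (hs : 1 ≤ s) (x y : EuclideanSpace ℝ (Fin d)) :
    mehler d m s x y ≤ Real.exp (8 * ‖x‖ ^ 2) * Real.exp (-‖y‖ ^ 2 / 2) *
      (Real.exp (-((d + m) * s)) * Real.exp (-(Real.exp (-(2 * s)) * ‖y‖) ^ 2 / 2)) := by
  have hs0 : 0 < s := by linarith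
  have h2s : 0 < 2 * s := by linarith
  set q := Real.exp (-(2 * s)) with hq
  have hq0 : 0 < q := Real.exp_pos _
  have hcoth := Real.one_add_two_mul_exp_le_inv_tanh h2s
  have hq2 : Real.exp (-(2 * (2 * s))) = q ^ 2 := by
    rw [hq, ← Real.exp_nat_mul]; push_cast; ring_nf
  rw [hq2] at hcoth
  have hsinh := Real.exp_le_four_mul_sinh (show 1 ≤ 2 * s by linarith)
  have hS : 0 < Real.sinh (2 * s) := Real.sinh_pos_iff.mpr h2s
  have hinv : (Real.sinh (2 * s))⁻¹ ≤ 4 * q := by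
    rw [hq, Real.exp_neg, inv_le_iff_one_le_mul₀ hS, mul_right_comm, ← div_eq_mul_inv,
      one_le_div (Real.exp_pos _)]
    exact hsinh
  have hcross : ⟪x, y⟫ / Real.sinh (2 * s) ≤ 4 * ‖x‖ * (q * ‖y‖) := by
    calc ⟪x, y⟫ / Real.sinh (2 * s) ≤ (‖x‖ * ‖y‖) * (Real.sinh (2 * s))⁻¹ := by
          rw [div_eq_mul_inv]
          gcongr
          exact real_inner_le_norm x y
      _ ≤ (‖x‖ * ‖y‖) * (4 * q) := by gcongr
      _ = _ := by ring
  have hexp : -‖x - y‖ ^ 2 / (2 * Real.tanh (2 * s)) - Real.tanh s * ⟪x, y⟫ ≤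
      8 * ‖x‖ ^ 2 + -‖y‖ ^ 2 / 2 + -(q * ‖y‖) ^ 2 / 2 := by
    rw [mehler_exponent_eq hs0]
    have h1 := mul_le_mul_of_nonneg_left hcoth
      (show 0 ≤ ‖x‖ ^ 2 + ‖y‖ ^ 2 by positivity)
    have h2 : 0 ≤ ‖x‖ ^ 2 * q ^ 2 := by positivity
    nlinarith [sq_nonneg (q * ‖y‖ - 4 * ‖x‖), sq_nonneg ‖x‖]
  have hpre : (2 * Real.pi * Real.sinh (2 * s)) ^ (-(d : ℝ) / 2) ≤ Real.exp (-(d * s)) := by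
    have h1 : Real.exp (2 * s) ≤ 2 * Real.pi * Real.sinh (2 * s) := by
      have := Real.pi_gt_three
      nlinarith
    have hd : -(d : ℝ) / 2 ≤ 0 := by
      have : (0 : ℝ) ≤ d := Nat.cast_nonneg d
      linarith
    refine (Real.rpow_le_rpow_of_nonpos (Real.exp_pos _) h1 hd).trans_eq ?_
    rw [← Real.exp_mul]
    ring_nf
  calc mehler d m s x y ≤ Real.exp (-s * m) * Real.exp (-(d * s)) *
        Real.exp (8 * ‖x‖ ^ 2 + -‖y‖ ^ 2 / 2 + -(q * ‖y‖) ^ 2 / 2) := by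
        unfold mehler
        gcongr
    _ = _ := by
        simp only [← Real.exp_add]
        ring_nf

/-- With `λ = log (1 + r) / 2`, the factor `exp (-(e^{-2s} r)² / 2)` decays exponentially in
`λ - s`. -/
theorem exp_neg_sq_le {r s N : ℝ} (hr : 0 ≤ r) (hs : 0 ≤ s) (hN : 0 ≤ N) :
    -(Real.exp (-(2 * s)) * r) ^ 2 / 2 ≤ N ^ 2 / 2 - 2 * N * (Real.log (1 + r) / 2 - s) := by
  set z := Real.exp (-(2 * s)) * r
  have hz : Real.log (1 + r) - 2 * s ≤ z := by
    have h1 : Real.exp (-(2 * s)) ≤ 1 := Real.exp_le_one_iff.mpr (by linarith)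
    have h2 : Real.exp (Real.log (1 + r) - 2 * s) ≤ Real.exp z := by
      rw [sub_eq_add_neg, Real.exp_add, Real.exp_log (by linarith)]
      have := Real.add_one_le_exp z
      simp only [z] at this ⊢
      linarith
    exact Real.exp_le_exp.mp h2
  nlinarith [sq_nonneg (z - N)]

theorem integrable_exp_neg_mul_abs {c : ℝ} (hc : 0 < c) :
    Integrable fun s : ℝ => Real.exp (-(c * |s|)) := by
  rw [← integrableOn_univ, ← Iic_union_Ioi (a := (0 : ℝ)), integrableOn_union]
  constructor
  · refine (integrableOn_exp_mul_Iic hc 0).congr_fun (fun s hs => ?_) measurableSet_Iic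
    simp [abs_of_nonpos (mem_Iic.mp hs)]
  · refine (integrableOn_exp_mul_Ioi (neg_neg_of_pos hc) 0).congr_fun (fun s hs => ?_)
      measurableSet_Ioi
    simp [abs_of_pos (mem_Ioi.mp hs)]

theorem exists_lintegral_exp_neg_abs_mul_rpow_le {κ p : ℝ} (hκ : 0 < κ) (hp : 0 ≤ p) :
    ∃ C > 0, ∀ l : ℝ, 0 ≤ l →
      ∫⁻ s in Ioi (1 : ℝ), ENNReal.ofReal (Real.exp (-(κ * |s - l|)) * s ^ (-p)) ≤
        ENNReal.ofReal (C * (1 + l) ^ (-p)) := by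
  have hq : 0 < κ / (2 * (p + 1)) := by positivity
  set q := κ / (2 * (p + 1)) with hqdef
  set M := 2 + q⁻¹ with hM
  have hM0 : 0 < M := by positivity
  have hint := integrable_exp_neg_mul_abs (show 0 < κ / 2 by positivity)
  set I := ∫ s : ℝ, Real.exp (-(κ / 2 * |s|)) with hI
  have hI0 : 0 ≤ I := integral_nonneg fun s => (Real.exp_pos _).le
  refine ⟨M ^ p * I + 1, by positivity, fun l hl => ?_⟩
  have hpt (s : ℝ) (hs : s ∈ Ioi (1 : ℝ)) :
      Real.exp (-(κ * |s - l|)) * s ^ (-p) ≤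
        M ^ p * (1 + l) ^ (-p) * Real.exp (-(κ / 2 * |s - l|)) := by
    have hs1 : 1 < s := hs
    set v := |s - l| with hv
    have hv0 : 0 ≤ v := abs_nonneg _
    have h1 : 1 + l ≤ s * (2 + v) := by
      have := neg_abs_le (s - l)
      nlinarith
    have h2 : 2 + v ≤ M * Real.exp (q * v) := by
      have h3 := Real.add_one_le_exp (q * v)
      have h4 : v = q⁻¹ * (q * v) := by field_simp
      have h5 : 0 < q⁻¹ := by positivity
      have h6 := Real.one_le_exp (show 0 ≤ q * v by positivity)
      rw [hM]
      have : v ≤ q⁻¹ * Real.exp (q * v) := by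
        calc v = q⁻¹ * (q * v) := h4
          _ ≤ _ := by gcongr; linarith
      nlinarith
    have h3 : (1 + l) ^ p ≤ s ^ p * (M ^ p * Real.exp (κ / 2 * v)) := by
      have h4 : p * q ≤ κ / 2 := by
        rw [hqdef]
        rw [mul_div_assoc', div_le_div_iff₀ (by positivity) (by positivity)]
        nlinarith
      calc (1 + l) ^ p ≤ (s * (M * Real.exp (q * v))) ^ p := by
            refine Real.rpow_le_rpow (by linarith) (h1.trans ?_) hp
            gcongr
        _ = s ^ p * (M ^ p * Real.exp (p * q * v)) := by
            rw [Real.mul_rpow (by linarith) (by positivity),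
              Real.mul_rpow hM0.le (Real.exp_pos _).le, ← Real.exp_mul]
            ring_nf
        _ ≤ _ := by gcongr
    rw [Real.rpow_neg (by linarith), Real.rpow_neg (by linarith)]
    have hsp : 0 < s ^ p := by positivity
    have hlp : 0 < (1 + l) ^ p := by positivity
    rw [← div_eq_mul_inv, div_le_iff₀ hsp]
    have e : Real.exp (-(κ * v)) = Real.exp (-(κ / 2 * v)) * Real.exp (-(κ / 2 * v)) := by
      rw [← Real.exp_add]; ring_nf
    have e' : Real.exp (-(κ / 2 * v)) * Real.exp (κ / 2 * v) = 1 := by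
      rw [← Real.exp_add]; simp
    calc Real.exp (-(κ * v)) = (Real.exp (-(κ / 2 * v)) * Real.exp (-(κ / 2 * v))) *
          ((1 + l) ^ p * ((1 + l) ^ p)⁻¹) := by rw [mul_inv_cancel₀ hlp.ne', e, mul_one]
      _ ≤ (Real.exp (-(κ / 2 * v)) * Real.exp (-(κ / 2 * v))) *
          ((s ^ p * (M ^ p * Real.exp (κ / 2 * v))) * ((1 + l) ^ p)⁻¹) := by gcongr
      _ = M ^ p * ((1 + l) ^ p)⁻¹ * Real.exp (-(κ / 2 * v)) * s ^ p *
          (Real.exp (-(κ / 2 * v)) * Real.exp (κ / 2 * v)) := by ring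
      _ = _ := by rw [e', mul_one]
  have hlp : 0 ≤ (1 + l) ^ (-p) := by positivity
  calc ∫⁻ s in Ioi (1 : ℝ), ENNReal.ofReal (Real.exp (-(κ * |s - l|)) * s ^ (-p))
      ≤ ∫⁻ s in Ioi (1 : ℝ), ENNReal.ofReal
          (M ^ p * (1 + l) ^ (-p) * Real.exp (-(κ / 2 * |s - l|))) :=
        setLIntegral_mono' measurableSet_Ioi fun s hs => ENNReal.ofReal_le_ofReal (hpt s hs)
    _ ≤ ∫⁻ s : ℝ, ENNReal.ofReal
          (M ^ p * (1 + l) ^ (-p) * Real.exp (-(κ / 2 * |s - l|))) :=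
        setLIntegral_le_lintegral _ _
    _ = ENNReal.ofReal (M ^ p * (1 + l) ^ (-p) * I) := by
        rw [lintegral_sub_right_eq_self (fun s : ℝ => ENNReal.ofReal
          (M ^ p * (1 + l) ^ (-p) * Real.exp (-(κ / 2 * |s|)))) l,
          ← ofReal_integral_eq_lintegral_ofReal (hint.const_mul _)
            (Eventually.of_forall fun s => by positivity), integral_const_mul]
    _ ≤ _ := by
        refine ENNReal.ofReal_le_ofReal ?_
        nlinarith

theorem lintegral_min_mul_rpow_le {σ : ℝ} (hσ : σ ∈ Ioo (0 : ℝ) 1) {Λ : ℝ} (hΛ : 0 < Λ) :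
    ∫⁻ s in Ioi (0 : ℝ), ENNReal.ofReal (min 1 (s / Λ) * s ^ (-(1 + σ))) ≤
      ENNReal.ofReal ((1 / (1 - σ) + 1 / σ) * Λ ^ (-σ)) := by
  obtain ⟨h0, h1⟩ := hσ
  have hsplit : Ioi (0 : ℝ) = Ioc 0 Λ ∪ Ioi Λ := (Ioc_union_Ioi_eq_Ioi hΛ.le).symm
  have hA : ∫⁻ s in Ioc (0 : ℝ) Λ, ENNReal.ofReal (min 1 (s / Λ) * s ^ (-(1 + σ))) ≤
      ENNReal.ofReal (1 / (1 - σ) * Λ ^ (-σ)) := by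
    have hint : IntegrableOn (fun s : ℝ => Λ⁻¹ * s ^ (-σ)) (Ioc 0 Λ) := by
      have := (intervalIntegral.intervalIntegrable_rpow' (a := 0) (b := Λ)
        (show -1 < -σ by linarith))
      rw [intervalIntegrable_iff_integrableOn_Ioc_of_le hΛ.le] at this
      exact this.const_mul _
    calc _ ≤ ∫⁻ s in Ioc (0 : ℝ) Λ, ENNReal.ofReal (Λ⁻¹ * s ^ (-σ)) := by
          refine setLIntegral_mono' measurableSet_Ioc fun s hs => ENNReal.ofReal_le_ofReal ?_
          have hs0 : 0 < s := hs.1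
          calc min 1 (s / Λ) * s ^ (-(1 + σ)) ≤ s / Λ * s ^ (-(1 + σ)) := by
                gcongr
                exact min_le_right _ _
            _ = Λ⁻¹ * s ^ (-σ) := by
                rw [show -σ = 1 + -(1 + σ) by ring, Real.rpow_add hs0, Real.rpow_one]
                ring
      _ = ENNReal.ofReal (∫ s in Ioc (0 : ℝ) Λ, Λ⁻¹ * s ^ (-σ)) := by
          rw [ofReal_integral_eq_lintegral_ofReal hint]
          filter_upwards [ae_restrict_mem measurableSet_Ioc] with s hs
          have hs0 : 0 < s := hs.1
          positivity
      _ = _ := by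
          rw [integral_const_mul, ← intervalIntegral.integral_of_le hΛ.le,
            integral_rpow (Or.inl (by linarith)), Real.zero_rpow (by linarith),
            Real.rpow_add hΛ, Real.rpow_one]
          congr 1
          have : 1 - σ ≠ 0 := by linarith
          have : -σ + 1 ≠ 0 := by linarith
          field_simp
          ring
  have hB : ∫⁻ s in Ioi Λ, ENNReal.ofReal (min 1 (s / Λ) * s ^ (-(1 + σ))) ≤
      ENNReal.ofReal (1 / σ * Λ ^ (-σ)) := by
    have hint := integrableOn_Ioi_rpow_of_lt (show -(1 + σ) < -1 by linarith) hΛ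
    calc _ ≤ ∫⁻ s in Ioi Λ, ENNReal.ofReal (s ^ (-(1 + σ))) := by
          refine setLIntegral_mono' measurableSet_Ioi fun s hs => ENNReal.ofReal_le_ofReal ?_
          have hs0 : 0 < s := hΛ.trans hs
          exact mul_le_of_le_one_left (by positivity) (min_le_left _ _)
      _ = ENNReal.ofReal (∫ s in Ioi Λ, s ^ (-(1 + σ))) := by
          rw [ofReal_integral_eq_lintegral_ofReal hint]
          filter_upwards [ae_restrict_mem measurableSet_Ioi] with s hs
          have hs0 : 0 < s := hΛ.trans hs
          positivity
      _ = _ := by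
          rw [integral_Ioi_rpow_of_lt (by linarith) hΛ]
          congr 1
          rw [show -(1 + σ) + 1 = -σ by ring]
          field_simp
  rw [hsplit]
  refine (lintegral_union_le _ _ _).trans ((add_le_add hA hB).trans_eq ?_)
  have : 0 < 1 - σ := by linarith
  rw [← ENNReal.ofReal_add (by positivity) (by positivity)]
  ring_nf

/-- The large-time part of the subordination integral is controlled by `PhiSigma`. -/
theorem exists_lintegral_mehler_large_le {σ : ℝ} (hσ : σ ∈ Ioo (0 : ℝ) 1) (hm : -(d : ℝ) ≤ m)
    (x : EuclideanSpace ℝ (Fin d)) :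
    ∃ C > 0, ∀ y : EuclideanSpace ℝ (Fin d),
      ∫⁻ s in Ioi (1 : ℝ), ENNReal.ofReal (mehler d m s x y * s ^ (-(1 + σ))) ≤
        ENNReal.ofReal (C * PhiSigma d m σ y) := by
  suffices h : ∃ C > 0, ∀ y : EuclideanSpace ℝ (Fin d),
      ∫⁻ s in Ioi (1 : ℝ), ENNReal.ofReal (Real.exp (-((d + m) * s)) *
        Real.exp (-(Real.exp (-(2 * s)) * ‖y‖) ^ 2 / 2) * s ^ (-(1 + σ))) ≤
        ENNReal.ofReal (C * (PhiSigma d m σ y / Real.exp (-‖y‖ ^ 2 / 2))) by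
    obtain ⟨C, hC, h⟩ := h
    refine ⟨Real.exp (8 * ‖x‖ ^ 2) * C, by positivity, fun y => ?_⟩
    set A := Real.exp (8 * ‖x‖ ^ 2) * Real.exp (-‖y‖ ^ 2 / 2) with hA
    have hA0 : 0 < A := by positivity
    calc _ ≤ ∫⁻ s in Ioi (1 : ℝ), ENNReal.ofReal A * ENNReal.ofReal (Real.exp (-((d + m) * s)) *
        Real.exp (-(Real.exp (-(2 * s)) * ‖y‖) ^ 2 / 2) * s ^ (-(1 + σ))) := by
          refine setLIntegral_mono' measurableSet_Ioi fun s hs => ?_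
          rw [← ENNReal.ofReal_mul hA0.le]
          have hs1 : 1 < s := hs
          refine ENNReal.ofReal_le_ofReal ?_
          rw [← mul_assoc]
          have := mehler_le_of_one_le (m := m) hs1.le x y
          gcongr
      _ = ENNReal.ofReal A * ∫⁻ s in Ioi (1 : ℝ), ENNReal.ofReal (Real.exp (-((d + m) * s)) *
        Real.exp (-(Real.exp (-(2 * s)) * ‖y‖) ^ 2 / 2) * s ^ (-(1 + σ))) :=
          lintegral_const_mul' _ _ ENNReal.ofReal_ne_top
      _ ≤ ENNReal.ofReal A * ENNReal.ofReal (C * (PhiSigma d m σ y / Real.exp (-‖y‖ ^ 2 / 2))) := by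
          gcongr
          exact h y
      _ = _ := by
          rw [← ENNReal.ofReal_mul hA0.le, hA]
          congr 1
          field_simp
  have hloglam (r : ℝ) (hr : 0 ≤ r) :
      Real.log (Real.exp 1 + r) ≤ 2 * (1 + Real.log (1 + r) / 2) := by
    have := log_exp_one_add_le hr
    linarith
  obtain ⟨hσ0, hσ1⟩ := hσ
  by_cases hmd : m = -(d : ℝ)
  · have hσ1' : 0 < 1 - σ := by linarith
    refine ⟨2 * Real.exp (1 / 2) * (1 / (1 - σ) + 1 / σ) * 2 ^ σ, by positivity, fun y => ?_⟩
    have hr := norm_nonneg y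
    set l := Real.log (1 + ‖y‖) / 2 with hl
    have hl0 : 0 ≤ l := by
      have := Real.log_nonneg (show 1 ≤ 1 + ‖y‖ by linarith)
      positivity
    have hpt (s : ℝ) (hs : s ∈ Ioi (1 : ℝ)) :
        Real.exp (-((d + m) * s)) * Real.exp (-(Real.exp (-(2 * s)) * ‖y‖) ^ 2 / 2) *
          s ^ (-(1 + σ)) ≤ 2 * Real.exp (1 / 2) * (min 1 (s / (1 + l)) * s ^ (-(1 + σ))) := by
      have hs1 : 1 < s := hs
      have hs0 : 0 < s := by linarith
      rw [← mul_assoc]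
      refine mul_le_mul_of_nonneg_right ?_ (by positivity)
      rw [hmd, add_neg_cancel, zero_mul, neg_zero, Real.exp_zero, one_mul]
      rw [mul_min_of_nonneg _ _ (by positivity)]
      refine le_min ?_ ?_
      · have h1 : Real.exp (-(Real.exp (-(2 * s)) * ‖y‖) ^ 2 / 2) ≤ 1 := by
          rw [Real.exp_le_one_iff, neg_div]
          have : 0 ≤ (Real.exp (-(2 * s)) * ‖y‖) ^ 2 / 2 := by positivity
          linarith
        have := Real.one_le_exp (show (0 : ℝ) ≤ 1 / 2 by norm_num)
        linarith
      · have h1 := exp_neg_sq_le hr hs0.le (show (0 : ℝ) ≤ 1 / 2 by norm_num)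
        rw [← hl] at h1
        have h2 : 1 + l ≤ 2 * s * Real.exp (l - s) ∨ l ≤ s := by
          rcases le_total l s with h | h
          · exact Or.inr h
          · left
            have := Real.add_one_le_exp (l - s)
            nlinarith
        rcases h2 with h2 | h2
        · calc Real.exp (-(Real.exp (-(2 * s)) * ‖y‖) ^ 2 / 2)
              ≤ Real.exp (1 / 2 + -(l - s)) := Real.exp_le_exp.mpr (by linarith)
            _ = Real.exp (1 / 2) * Real.exp (-(l - s)) * 1 := by rw [Real.exp_add, mul_one]
            _ ≤ Real.exp (1 / 2) * Real.exp (-(l - s)) *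
                ((2 * s * Real.exp (l - s)) / (1 + l)) := by
                gcongr
                rwa [one_le_div (by linarith)]
            _ = 2 * Real.exp (1 / 2) * (s / (1 + l)) *
                (Real.exp (-(l - s)) * Real.exp (l - s)) := by ring
            _ = _ := by rw [← Real.exp_add]; simp
        · have h3 : Real.exp (-(Real.exp (-(2 * s)) * ‖y‖) ^ 2 / 2) ≤ 1 := by
            rw [Real.exp_le_one_iff, neg_div]
            have : 0 ≤ (Real.exp (-(2 * s)) * ‖y‖) ^ 2 / 2 := by positivity
            linarith
          have h4 := Real.one_le_exp (show (0 : ℝ) ≤ 1 / 2 by norm_num)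
          have h5 : 1 / 2 ≤ s / (1 + l) := by
            rw [div_le_div_iff₀ (by norm_num) (by linarith)]
            linarith
          nlinarith
    calc _ ≤ ∫⁻ s in Ioi (1 : ℝ), ENNReal.ofReal (2 * Real.exp (1 / 2)) *
          ENNReal.ofReal (min 1 (s / (1 + l)) * s ^ (-(1 + σ))) := by
          refine setLIntegral_mono' measurableSet_Ioi fun s hs => ?_
          rw [← ENNReal.ofReal_mul (by positivity)]
          exact ENNReal.ofReal_le_ofReal (hpt s hs)
      _ = ENNReal.ofReal (2 * Real.exp (1 / 2)) * ∫⁻ s in Ioi (1 : ℝ),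
          ENNReal.ofReal (min 1 (s / (1 + l)) * s ^ (-(1 + σ))) :=
          lintegral_const_mul' _ _ ENNReal.ofReal_ne_top
      _ ≤ ENNReal.ofReal (2 * Real.exp (1 / 2)) *
          ENNReal.ofReal ((1 / (1 - σ) + 1 / σ) * (1 + l) ^ (-σ)) := by
          gcongr
          refine (lintegral_mono_set (Ioi_subset_Ioi zero_le_one)).trans ?_
          exact lintegral_min_mul_rpow_le ⟨hσ0, hσ1⟩ (by linarith)
      _ ≤ _ := by
          rw [← ENNReal.ofReal_mul (by positivity)]
          refine ENNReal.ofReal_le_ofReal ?_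
          have hlog := one_le_log_exp_one_add hr
          rw [PhiSigma_eq_div, if_pos hmd, div_div_cancel_left' (Real.exp_pos _).ne',
            mul_assoc (2 * Real.exp (1 / 2) * (1 / (1 - σ) + 1 / σ)), ← mul_assoc (2 * Real.exp (1 / 2))]
          refine mul_le_mul_of_nonneg_left ?_ (by positivity)
          rw [Real.rpow_neg (by linarith), ← div_eq_mul_inv, le_div_iff₀ (by positivity),
            inv_mul_le_iff₀ (by positivity), mul_comm, ← Real.mul_rpow (by norm_num) (by linarith)]
          exact Real.rpow_le_rpow (by linarith) (hloglam _ hr) hσ0.le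
  · have hκ : 0 < d + m := by
      rcases lt_or_eq_of_le hm with h | h
      · linarith
      · exact absurd h.symm hmd
    obtain ⟨C, hC, hbound⟩ := exists_lintegral_exp_neg_abs_mul_rpow_le hκ
      (show 0 ≤ 1 + σ by linarith)
    set κ := (d : ℝ) + m with hκdef
    refine ⟨Real.exp (κ ^ 2 / 2) * C * 2 ^ (1 + σ), by positivity, fun y => ?_⟩
    have hr := norm_nonneg y
    set l := Real.log (1 + ‖y‖) / 2 with hl
    have hl0 : 0 ≤ l := by
      have := Real.log_nonneg (show 1 ≤ 1 + ‖y‖ by linarith)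
      positivity
    have hpt (s : ℝ) (hs : s ∈ Ioi (1 : ℝ)) :
        Real.exp (-(κ * s)) * Real.exp (-(Real.exp (-(2 * s)) * ‖y‖) ^ 2 / 2) *
          s ^ (-(1 + σ)) ≤ Real.exp (κ ^ 2 / 2) * Real.exp (-(κ * l)) *
            (Real.exp (-(κ * |s - l|)) * s ^ (-(1 + σ))) := by
      have hs1 : 1 < s := hs
      have hs0 : 0 < s := by linarith
      rw [← mul_assoc]
      refine mul_le_mul_of_nonneg_right ?_ (by positivity)
      rw [← Real.exp_add, ← Real.exp_add, ← Real.exp_add, Real.exp_le_exp]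
      rcases le_total s l with h | h
      · have h1 := exp_neg_sq_le hr hs0.le hκ.le
        rw [← hl] at h1
        rw [abs_of_nonpos (by linarith)]
        linarith
      · rw [abs_of_nonneg (by linarith), neg_div]
        have : 0 ≤ (Real.exp (-(2 * s)) * ‖y‖) ^ 2 / 2 := by positivity
        have : 0 ≤ κ ^ 2 / 2 := by positivity
        linarith
    calc _ ≤ ∫⁻ s in Ioi (1 : ℝ), ENNReal.ofReal (Real.exp (κ ^ 2 / 2) * Real.exp (-(κ * l))) *
          ENNReal.ofReal (Real.exp (-(κ * |s - l|)) * s ^ (-(1 + σ))) := by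
          refine setLIntegral_mono' measurableSet_Ioi fun s hs => ?_
          rw [← ENNReal.ofReal_mul (by positivity)]
          exact ENNReal.ofReal_le_ofReal (hpt s hs)
      _ = ENNReal.ofReal (Real.exp (κ ^ 2 / 2) * Real.exp (-(κ * l))) * ∫⁻ s in Ioi (1 : ℝ),
          ENNReal.ofReal (Real.exp (-(κ * |s - l|)) * s ^ (-(1 + σ))) :=
          lintegral_const_mul' _ _ ENNReal.ofReal_ne_top
      _ ≤ ENNReal.ofReal (Real.exp (κ ^ 2 / 2) * Real.exp (-(κ * l))) *
          ENNReal.ofReal (C * (1 + l) ^ (-(1 + σ))) := by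
          gcongr
          exact hbound l hl0
      _ ≤ _ := by
          rw [← ENNReal.ofReal_mul (by positivity)]
          refine ENNReal.ofReal_le_ofReal ?_
          have hlog := one_le_log_exp_one_add hr
          have e1 : (1 + ‖y‖) ^ (κ / 2) = Real.exp (κ * l) := by
            rw [Real.rpow_def_of_pos (by linarith), hl]
            ring_nf
          rw [PhiSigma_eq_div, if_neg hmd, div_div_cancel_left' (Real.exp_pos _).ne', e1,
            mul_inv, ← Real.exp_neg]
          have h2 : (1 + l) ^ (-(1 + σ)) ≤
              2 ^ (1 + σ) * (Real.log (Real.exp 1 + ‖y‖) ^ (1 + σ))⁻¹ := by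
            rw [Real.rpow_neg (by linarith), ← div_eq_mul_inv, le_div_iff₀ (by positivity),
              inv_mul_le_iff₀ (by positivity), mul_comm,
              ← Real.mul_rpow (by norm_num) (by linarith)]
            exact Real.rpow_le_rpow (by linarith) (hloglam _ hr) (by linarith)
          calc Real.exp (κ ^ 2 / 2) * Real.exp (-(κ * l)) * (C * (1 + l) ^ (-(1 + σ)))
              ≤ Real.exp (κ ^ 2 / 2) * Real.exp (-(κ * l)) *
                (C * (2 ^ (1 + σ) * (Real.log (Real.exp 1 + ‖y‖) ^ (1 + σ))⁻¹)) := by gcongr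
            _ = _ := by ring

end LargeTime

section Subordination

theorem integrableOn_rpow_mul_exp_neg_div {p c : ℝ} (hp : 0 < p) (hc : 0 < c) :
    IntegrableOn (fun s : ℝ => s ^ (-1 - p) * Real.exp (-c / s)) (Ioi 0) ∧
      ∫ s in Ioi (0 : ℝ), s ^ (-1 - p) * Real.exp (-c / s) = c ^ (-p) * Real.Gamma p := by
  set g : ℝ → ℝ := fun y => y ^ (p - 1) * Real.exp (-(c * y)) with hg
  have hcongr : ∀ s ∈ Ioi (0 : ℝ), (|(-1 : ℝ)| * s ^ ((-1 : ℝ) - 1)) • g (s ^ (-1 : ℝ)) =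
      s ^ (-1 - p) * Real.exp (-c / s) := by
    intro s hs
    have hs0 : 0 < s := hs
    simp only [hg, smul_eq_mul, abs_neg, abs_one, one_mul]
    rw [← Real.rpow_mul hs0.le, ← mul_assoc, ← Real.rpow_add hs0, Real.rpow_neg_one]
    ring_nf
  have hgint : ∫ y in Ioi (0 : ℝ), g y = c ^ (-p) * Real.Gamma p := by
    rw [hg, Real.integral_rpow_mul_exp_neg_mul_Ioi hp hc, one_div, Real.inv_rpow hc.le,
      Real.rpow_neg hc.le]
  constructor
  · have hgi : IntegrableOn g (Ioi 0) := by
      by_contra h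
      rw [integral_undef h] at hgint
      have := Real.Gamma_pos_of_pos hp
      have : 0 < c ^ (-p) * Real.Gamma p := by positivity
      linarith
    exact ((integrableOn_Ioi_comp_rpow_iff g (by norm_num : (-1 : ℝ) ≠ 0)).mpr hgi).congr_fun
      hcongr measurableSet_Ioi
  · rw [← hgint, ← integral_comp_rpow_Ioi g (by norm_num : (-1 : ℝ) ≠ 0)]
    exact (setIntegral_congr_fun measurableSet_Ioi hcongr).symm

theorem lintegral_rpow_mul_exp_neg_div {p c : ℝ} (hp : 0 < p) (hc : 0 < c) :
    ∫⁻ s in Ioi (0 : ℝ), ENNReal.ofReal (s ^ (-1 - p) * Real.exp (-c / s)) =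
      ENNReal.ofReal (c ^ (-p) * Real.Gamma p) := by
  obtain ⟨h1, h2⟩ := integrableOn_rpow_mul_exp_neg_div hp hc
  rw [← h2, ofReal_integral_eq_lintegral_ofReal h1]
  filter_upwards [ae_restrict_mem measurableSet_Ioi] with s hs
  have hs0 : 0 < s := hs
  positivity

theorem exists_lintegral_rpow_mul_exp_neg_sq_le (D : ℝ) :
    ∃ C > 0, ∀ r : ℝ, 0 < r →
      ∫⁻ s in Ioc (0 : ℝ) 1, ENNReal.ofReal (r * s ^ (-(D / 2)) * Real.exp (-(r ^ 2 / 4) / s)) ≤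
        ENNReal.ofReal (C / r ^ max (D - 3) 0) := by
  rcases le_or_gt 3 D with hD | hD
  · have hp : 0 < D / 2 - 1 := by linarith
    have hG := Real.Gamma_pos_of_pos hp
    refine ⟨4 ^ (D / 2 - 1) * Real.Gamma (D / 2 - 1), by positivity, fun r hr => ?_⟩
    calc _ ≤ ∫⁻ s in Ioi (0 : ℝ), ENNReal.ofReal r *
          ENNReal.ofReal (s ^ (-1 - (D / 2 - 1)) * Real.exp (-(r ^ 2 / 4) / s)) := by
          refine (lintegral_mono_set Ioc_subset_Ioi_self).trans_eq ?_
          refine lintegral_congr fun s => ?_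
          rw [← ENNReal.ofReal_mul hr.le, mul_assoc]
          ring_nf
      _ = ENNReal.ofReal (r * ((r ^ 2 / 4) ^ (-(D / 2 - 1)) * Real.Gamma (D / 2 - 1))) := by
          rw [lintegral_const_mul' _ _ ENNReal.ofReal_ne_top,
            lintegral_rpow_mul_exp_neg_div hp (by positivity), ← ENNReal.ofReal_mul hr.le]
      _ = _ := by
          congr 1
          rw [max_eq_left (by linarith), Real.rpow_neg (by positivity),
            Real.div_rpow (by positivity) (by norm_num), ← Real.rpow_natCast,
            ← Real.rpow_mul hr.le]
          have e : r ^ (((2 : ℕ) : ℝ) * (D / 2 - 1)) = r * r ^ (D - 3) := by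
            rw [mul_comm r, ← Real.rpow_add_one hr.ne']
            push_cast
            ring_nf
          rw [e]
          field_simp
  · have hexp : -1 < 1 / 2 - D / 2 := by linarith
    have hint : IntegrableOn (fun s : ℝ => 2 * s ^ (1 / 2 - D / 2)) (Ioc 0 1) := by
      have := intervalIntegral.intervalIntegrable_rpow' (a := 0) (b := 1) hexp
      rw [intervalIntegrable_iff_integrableOn_Ioc_of_le zero_le_one] at this
      exact this.const_mul _
    set I := ∫ s in Ioc (0 : ℝ) 1, 2 * s ^ (1 / 2 - D / 2) with hI
    have hnn : ∀ᵐ s ∂(volume.restrict (Ioc (0 : ℝ) 1)), 0 ≤ 2 * s ^ (1 / 2 - D / 2) := by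
      filter_upwards [ae_restrict_mem measurableSet_Ioc] with s hs
      have hs0 : 0 < s := hs.1
      positivity
    have hI0 : 0 ≤ I := integral_nonneg_of_ae hnn
    refine ⟨I + 1, by positivity, fun r hr => ?_⟩
    rw [max_eq_right (by linarith), Real.rpow_zero, div_one]
    calc _ ≤ ∫⁻ s in Ioc (0 : ℝ) 1, ENNReal.ofReal (2 * s ^ (1 / 2 - D / 2)) := by
          refine setLIntegral_mono' measurableSet_Ioc fun s hs => ENNReal.ofReal_le_ofReal ?_
          have hs0 : 0 < s := hs.1
          have hsq : 0 < √s := Real.sqrt_pos.mpr hs0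
          set u := r / (2 * √s) with hu
          have hu2 : -(r ^ 2 / 4) / s = -u ^ 2 := by
            rw [hu, div_pow, mul_pow, Real.sq_sqrt hs0.le]
            field_simp
            norm_num
          have hr' : r = 2 * √s * u := by rw [hu]; field_simp
          have hue : u * Real.exp (-u ^ 2) ≤ 1 := by
            rw [Real.exp_neg, ← div_eq_mul_inv, div_le_one (Real.exp_pos _)]
            have := Real.add_one_le_exp (u ^ 2)
            nlinarith [sq_nonneg (u - 1)]
          calc r * s ^ (-(D / 2)) * Real.exp (-(r ^ 2 / 4) / s)
              = 2 * (√s * s ^ (-(D / 2))) * (u * Real.exp (-u ^ 2)) := by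
                rw [hu2]
                linear_combination s ^ (-(D / 2)) * Real.exp (-u ^ 2) * hr'
            _ ≤ 2 * (√s * s ^ (-(D / 2))) * 1 := by gcongr
            _ = _ := by
                rw [Real.sqrt_eq_rpow, ← Real.rpow_add hs0]
                ring_nf
      _ = ENNReal.ofReal I := by rw [hI, ofReal_integral_eq_lintegral_ofReal hint hnn]
      _ ≤ _ := ENNReal.ofReal_le_ofReal (by linarith)

theorem integrable_prod_of_lintegral_le {α β : Type*} [MeasurableSpace α] [MeasurableSpace β]
    {μ : Measure α} {ν : Measure β} [SFinite μ] [SFinite ν] {F : α × β → ℝ}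
    (hF : AEStronglyMeasurable F (μ.prod ν)) {g : β → ℝ} (hg : Integrable g ν)
    (h : ∀ y, ∫⁻ s, ‖F (s, y)‖ₑ ∂μ ≤ ENNReal.ofReal (g y)) :
    Integrable F (μ.prod ν) := by
  refine ⟨hF, ?_⟩
  rw [hasFiniteIntegral_iff_enorm, lintegral_prod_symm _ hF.enorm]
  exact (lintegral_mono h).trans_lt hg.lintegral_lt_top

/-- Behaviour of `∫ e^{-t²/(4s)} g(s) ds` for integrable `g`. -/
theorem hasDerivAt_integral_exp_neg_sq_div {g : ℝ → ℝ} (hg : IntegrableOn g (Ioi 0)) {t : ℝ}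
    (ht : 0 < t) :
    HasDerivAt (fun u : ℝ => ∫ s in Ioi (0 : ℝ), Real.exp (-u ^ 2 / (4 * s)) * g s)
      (∫ s in Ioi (0 : ℝ), -(t / (2 * s)) * Real.exp (-t ^ 2 / (4 * s)) * g s) t := by
  have hmeas (u : ℝ) : AEStronglyMeasurable (fun s : ℝ => Real.exp (-u ^ 2 / (4 * s)))
      (volume.restrict (Ioi 0)) := by
    have : Measurable fun s : ℝ => Real.exp (-u ^ 2 / (4 * s)) := by fun_prop
    exact this.aestronglyMeasurable
  have hle (u s : ℝ) (hs : 0 < s) : Real.exp (-u ^ 2 / (4 * s)) ≤ 1 := by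
    rw [Real.exp_le_one_iff, neg_div]
    have : 0 ≤ u ^ 2 / (4 * s) := by positivity
    linarith
  refine (hasDerivAt_integral_of_dominated_loc_of_deriv_le (μ := volume.restrict (Ioi (0 : ℝ)))
    (F := fun (u : ℝ) (s : ℝ) => Real.exp (-u ^ 2 / (4 * s)) * g s)
    (F' := fun u s => -(u / (2 * s)) * Real.exp (-u ^ 2 / (4 * s)) * g s)
    (bound := fun s => 4 / t * ‖g s‖) (s := Ioi (t / 2))
    (Ioi_mem_nhds (by linarith)) ?_ ?_ ?_ ?_ ?_ ?_).2
  · exact Eventually.of_forall fun u => (hmeas u).mul hg.aestronglyMeasurable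
  · refine hg.norm.mono' ((hmeas t).mul hg.aestronglyMeasurable) ?_
    filter_upwards [ae_restrict_mem measurableSet_Ioi] with s hs
    rw [norm_mul, Real.norm_of_nonneg (Real.exp_pos _).le]
    exact mul_le_of_le_one_left (norm_nonneg _) (hle t s hs)
  · have : Measurable fun s : ℝ => -(t / (2 * s)) := by fun_prop
    exact (this.aestronglyMeasurable.mul (hmeas t)).mul hg.aestronglyMeasurable
  · filter_upwards [ae_restrict_mem measurableSet_Ioi] with s hs u hu
    have hs0 : 0 < s := hs
    have hut : t / 2 < u := hu
    have hu0 : 0 < u := by linarith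
    rw [norm_mul, norm_mul, norm_neg, Real.norm_of_nonneg (Real.exp_pos _).le,
      Real.norm_of_nonneg (by positivity : 0 ≤ u / (2 * s))]
    gcongr
    have h1 : u / (2 * s) = 2 / u * (u ^ 2 / (4 * s)) := by field_simp; norm_num
    have h2 : u ^ 2 / (4 * s) * Real.exp (-u ^ 2 / (4 * s)) ≤ 1 := by
      rw [neg_div, Real.exp_neg, ← div_eq_mul_inv, div_le_one (Real.exp_pos _)]
      linarith [Real.add_one_le_exp (u ^ 2 / (4 * s))]
    calc u / (2 * s) * Real.exp (-u ^ 2 / (4 * s))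
        = 2 / u * (u ^ 2 / (4 * s) * Real.exp (-u ^ 2 / (4 * s))) := by rw [h1]; ring
      _ ≤ 2 / u * 1 := by gcongr
      _ ≤ 4 / t := by
        rw [mul_one, div_le_div_iff₀ hu0 ht]
        linarith
  · exact hg.norm.const_mul _
  · filter_upwards [ae_restrict_mem measurableSet_Ioi] with s hs u _
    have hs0 : 0 < s := hs
    refine HasDerivAt.mul_const ?_ (g s)
    have h1 : HasDerivAt (fun u : ℝ => -u ^ 2 / (4 * s)) (-(u / (2 * s))) u := by
      refine (((hasDerivAt_pow 2 u).neg).div_const (4 * s)).congr_deriv ?_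
      push_cast
      field_simp
      ring
    exact h1.exp.congr_deriv (by ring)

theorem tendsto_integral_exp_neg_sq_div {g : ℝ → ℝ} (hg : IntegrableOn g (Ioi 0)) :
    Tendsto (fun u : ℝ => ∫ s in Ioi (0 : ℝ), Real.exp (-u ^ 2 / (4 * s)) * g s)
      (nhdsWithin 0 (Ioi 0)) (nhds (∫ s in Ioi (0 : ℝ), g s)) := by
  refine tendsto_integral_filter_of_dominated_convergence (fun s => ‖g s‖) ?_ ?_ hg.norm ?_
  · refine Eventually.of_forall fun u => AEStronglyMeasurable.mul ?_ hg.aestronglyMeasurable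
    have : Measurable fun s : ℝ => Real.exp (-u ^ 2 / (4 * s)) := by fun_prop
    exact this.aestronglyMeasurable
  · refine Eventually.of_forall fun u => ?_
    filter_upwards [ae_restrict_mem measurableSet_Ioi] with s hs
    have hs0 : 0 < s := hs
    rw [norm_mul, Real.norm_of_nonneg (Real.exp_pos _).le]
    refine mul_le_of_le_one_left (norm_nonneg _) ?_
    rw [Real.exp_le_one_iff, neg_div]
    have : 0 ≤ u ^ 2 / (4 * s) := by positivity
    linarith
  · filter_upwards [ae_restrict_mem measurableSet_Ioi] with s hs
    have : Continuous fun u : ℝ => Real.exp (-u ^ 2 / (4 * s)) * g s := by fun_prop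
    simpa using (this.tendsto 0).mono_left nhdsWithin_le_nhds

theorem tendsto_mul_integral_deriv_exp_neg_sq_div {g : ℝ → ℝ} (hg : IntegrableOn g (Ioi 0)) :
    Tendsto (fun t : ℝ => t * ∫ s in Ioi (0 : ℝ),
        -(t / (2 * s)) * Real.exp (-t ^ 2 / (4 * s)) * g s)
      (nhdsWithin 0 (Ioi 0)) (nhds 0) := by
  simp_rw [← integral_const_mul]
  rw [show nhds (0 : ℝ) = nhds (∫ s in Ioi (0 : ℝ), (0 : ℝ)) by simp]
  refine tendsto_integral_filter_of_dominated_convergence (fun s => 2 * ‖g s‖) ?_ ?_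
    (hg.norm.const_mul 2) ?_
  · refine Eventually.of_forall fun t => ?_
    have : Measurable fun s : ℝ => -(t / (2 * s)) * Real.exp (-t ^ 2 / (4 * s)) := by fun_prop
    exact (this.aestronglyMeasurable.mul hg.aestronglyMeasurable).const_mul t
  · refine Eventually.of_forall fun t => ?_
    filter_upwards [ae_restrict_mem measurableSet_Ioi] with s hs
    have hs0 : 0 < s := hs
    have e : t * (-(t / (2 * s)) * Real.exp (-t ^ 2 / (4 * s)) * g s) =
        -(2 * (t ^ 2 / (4 * s) * Real.exp (-t ^ 2 / (4 * s))) * g s) := by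
      field_simp
      norm_num
    have h2 : t ^ 2 / (4 * s) * Real.exp (-t ^ 2 / (4 * s)) ≤ 1 := by
      rw [neg_div, Real.exp_neg, ← div_eq_mul_inv, div_le_one (Real.exp_pos _)]
      linarith [Real.add_one_le_exp (t ^ 2 / (4 * s))]
    rw [e, norm_neg, norm_mul, Real.norm_of_nonneg (by positivity)]
    gcongr
    linarith
  · filter_upwards [ae_restrict_mem measurableSet_Ioi] with s hs
    have : Continuous fun t : ℝ => t * (-(t / (2 * s)) * Real.exp (-t ^ 2 / (4 * s)) * g s) := by
      fun_prop
    simpa using (this.tendsto 0).mono_left nhdsWithin_le_nhds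

end Subordination

section HeatSemigroup

variable {d : ℕ} {m σ : ℝ} {f : EuclideanSpace ℝ (Fin d) → ℝ}

theorem exists_lintegral_mehler_small_le (hσ : σ ∈ Ioo (0 : ℝ) 1) (hm : -(d : ℝ) ≤ m)
    (x : EuclideanSpace ℝ (Fin d)) {a : ℝ} (ha : 0 < a) :
    ∃ C > 0, ∀ y : EuclideanSpace ℝ (Fin d), ∀ w : ℝ → ℝ,
      (∀ s, 0 < s → s ≤ 1 → w s ≤ Real.exp (-a / s) ∨ a ≤ ‖x - y‖ ^ 2 ∧ w s ≤ 1) →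
      ∫⁻ s in Ioc (0 : ℝ) 1, ENNReal.ofReal (w s * mehler d m s x y * s ^ (-(1 + σ))) ≤
        ENNReal.ofReal (C * PhiSigma d m σ y) := by
  obtain ⟨C, hC, c, hc, hbound⟩ := exists_mehler_le_of_le_one hσ.1.le hm x
  have hp : 0 < (d : ℝ) / 2 + σ := by
    have := hσ.1
    positivity
  have hG := Real.Gamma_pos_of_pos hp
  set b := min a (c * a) with hb
  have hb0 : 0 < b := lt_min ha (by positivity)
  refine ⟨C * (b ^ (-((d : ℝ) / 2 + σ)) * Real.Gamma ((d : ℝ) / 2 + σ)), by positivity,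
    fun y w hw => ?_⟩
  have hPhi := PhiSigma_pos (m := m) (σ := σ) y
  calc _ ≤ ∫⁻ s in Ioc (0 : ℝ) 1, ENNReal.ofReal (C * PhiSigma d m σ y) *
        ENNReal.ofReal (s ^ (-1 - ((d : ℝ) / 2 + σ)) * Real.exp (-b / s)) := by
        refine setLIntegral_mono' measurableSet_Ioc fun s hs => ?_
        rw [← ENNReal.ofReal_mul (by positivity)]
        refine ENNReal.ofReal_le_ofReal ?_
        have hs0 : 0 < s := hs.1
        have hwh : w s * mehler d m s x y ≤
            C * s ^ (-(d : ℝ) / 2) * Real.exp (-b / s) * PhiSigma d m σ y := by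
          have h1 := hbound s hs.1 hs.2 y
          have h0 := mehler_nonneg (m := m) hs0.le x y
          rcases hw s hs.1 hs.2 with h | ⟨h, h'⟩
          · have h2 : Real.exp (-(c * ‖x - y‖ ^ 2) / s) ≤ 1 := by
              rw [Real.exp_le_one_iff, neg_div]
              have : 0 ≤ c * ‖x - y‖ ^ 2 / s := by positivity
              linarith
            have h3 : w s ≤ Real.exp (-b / s) := by
              refine h.trans (Real.exp_le_exp.mpr ?_)
              gcongr
              exact min_le_left _ _
            calc w s * mehler d m s x y ≤ Real.exp (-b / s) *
                  (C * s ^ (-(d : ℝ) / 2) * 1 * PhiSigma d m σ y) := by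
                  refine mul_le_mul h3 (h1.trans ?_) h0 (Real.exp_pos _).le
                  gcongr
              _ = _ := by ring
          · refine (mul_le_of_le_one_left h0 h').trans (h1.trans ?_)
            gcongr
            exact (min_le_right _ _).trans (by gcongr)
        calc w s * mehler d m s x y * s ^ (-(1 + σ))
            ≤ C * s ^ (-(d : ℝ) / 2) * Real.exp (-b / s) * PhiSigma d m σ y *
              s ^ (-(1 + σ)) := by gcongr
          _ = _ := by
            rw [show -1 - ((d : ℝ) / 2 + σ) = -(d : ℝ) / 2 + -(1 + σ) by ring,
              Real.rpow_add hs0]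
            ring
    _ ≤ ENNReal.ofReal (C * PhiSigma d m σ y) * ∫⁻ s in Ioi (0 : ℝ),
        ENNReal.ofReal (s ^ (-1 - ((d : ℝ) / 2 + σ)) * Real.exp (-b / s)) := by
        rw [lintegral_const_mul' _ _ ENNReal.ofReal_ne_top]
        gcongr
        exact Ioc_subset_Ioi_self
    _ = _ := by
        rw [lintegral_rpow_mul_exp_neg_div hp hb0, ← ENNReal.ofReal_mul (by positivity)]
        ring_nf

theorem integrable_mehler_mul_prod_large (hσ : σ ∈ Ioo (0 : ℝ) 1) (hm : -(d : ℝ) ≤ m)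
    (hf : Measurable f) (hfint : Integrable fun y => |f y| * PhiSigma d m σ y)
    (x : EuclideanSpace ℝ (Fin d)) :
    Integrable (fun p : ℝ × EuclideanSpace ℝ (Fin d) =>
      mehler d m p.1 x p.2 * p.1 ^ (-(1 + σ)) * f p.2)
      ((volume.restrict (Ioi 1)).prod volume) := by
  obtain ⟨C, hC, hbound⟩ := exists_lintegral_mehler_large_le hσ hm x
  have hmeas := measurable_mehler d m x
  refine integrable_prod_of_lintegral_le (by fun_prop) (hfint.const_mul C) fun y => ?_
  calc _ = ∫⁻ s in Ioi (1 : ℝ), ENNReal.ofReal (mehler d m s x y * s ^ (-(1 + σ))) *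
        ENNReal.ofReal |f y| := by
        refine setLIntegral_congr_fun measurableSet_Ioi fun s hs => ?_
        have hs0 : 0 < s := zero_lt_one.trans hs
        have h0 := mehler_nonneg (m := m) hs0.le x y
        simp only
        rw [enorm_mul, Real.enorm_of_nonneg (by positivity), Real.enorm_eq_ofReal_abs]
    _ = (∫⁻ s in Ioi (1 : ℝ), ENNReal.ofReal (mehler d m s x y * s ^ (-(1 + σ)))) *
        ENNReal.ofReal |f y| := lintegral_mul_const' _ _ ENNReal.ofReal_ne_top
    _ ≤ ENNReal.ofReal (C * PhiSigma d m σ y) * ENNReal.ofReal |f y| := by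
        gcongr
        exact hbound y
    _ = _ := by
        rw [← ENNReal.ofReal_mul (mul_nonneg hC.le (PhiSigma_pos y).le)]
        ring_nf

theorem integrable_poisson_prod (hσ : σ ∈ Ioo (0 : ℝ) 1) (hm : -(d : ℝ) ≤ m)
    (hf : Measurable f) (hfint : Integrable fun y => |f y| * PhiSigma d m σ y)
    (x : EuclideanSpace ℝ (Fin d)) {t : ℝ} (ht : 0 < t) :
    Integrable (fun p : ℝ × EuclideanSpace ℝ (Fin d) =>
      Real.exp (-t ^ 2 / (4 * p.1)) * mehler d m p.1 x p.2 * p.1 ^ (-(1 + σ)) * f p.2)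
      ((volume.restrict (Ioi 0)).prod volume) := by
  obtain ⟨C₁, hC₁, h₁⟩ := exists_lintegral_mehler_large_le hσ hm x
  obtain ⟨C₂, hC₂, h₂⟩ := exists_lintegral_mehler_small_le hσ hm x
    (show 0 < t ^ 2 / 4 by positivity)
  have hmeas := measurable_mehler d m x
  refine integrable_prod_of_lintegral_le (by fun_prop) (hfint.const_mul (C₂ + C₁)) fun y => ?_
  have hPhi := PhiSigma_pos (m := m) (σ := σ) y
  calc _ = ∫⁻ s in Ioi (0 : ℝ), ENNReal.ofReal (Real.exp (-t ^ 2 / (4 * s)) *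
        mehler d m s x y * s ^ (-(1 + σ))) * ENNReal.ofReal |f y| := by
        refine setLIntegral_congr_fun measurableSet_Ioi fun s hs => ?_
        have hs0 : 0 < s := hs
        have h0 := mehler_nonneg (m := m) hs0.le x y
        simp only
        rw [enorm_mul, Real.enorm_of_nonneg (by positivity), Real.enorm_eq_ofReal_abs]
    _ = (∫⁻ s in Ioi (0 : ℝ), ENNReal.ofReal (Real.exp (-t ^ 2 / (4 * s)) *
        mehler d m s x y * s ^ (-(1 + σ)))) * ENNReal.ofReal |f y| :=
        lintegral_mul_const' _ _ ENNReal.ofReal_ne_top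
    _ ≤ (ENNReal.ofReal (C₂ * PhiSigma d m σ y) + ENNReal.ofReal (C₁ * PhiSigma d m σ y)) *
        ENNReal.ofReal |f y| := by
        gcongr
        rw [← Ioc_union_Ioi_eq_Ioi (zero_le_one' ℝ)]
        refine (lintegral_union_le _ _ _).trans (add_le_add ?_ (le_trans ?_ (h₁ y)))
        · refine h₂ y _ fun s hs0 hs1 => Or.inl (le_of_eq ?_)
          congr 1
          field_simp
        · refine setLIntegral_mono' measurableSet_Ioi fun s hs => ENNReal.ofReal_le_ofReal ?_
          have hs0 : 0 < s := zero_lt_one.trans hs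
          have h0 := mehler_nonneg (m := m) hs0.le x y
          gcongr
          refine mul_le_of_le_one_left h0 ?_
          rw [Real.exp_le_one_iff, neg_div]
          have : 0 ≤ t ^ 2 / (4 * s) := by positivity
          linarith
    _ = _ := by
        rw [← ENNReal.ofReal_add (by positivity) (by positivity),
          ← ENNReal.ofReal_mul (by positivity)]
        ring_nf

theorem integrable_mehler_mul_small (hσ : σ ∈ Ioo (0 : ℝ) 1) (hm : -(d : ℝ) ≤ m)
    (hf : Measurable f) (hfint : Integrable fun y => |f y| * PhiSigma d m σ y)
    (x : EuclideanSpace ℝ (Fin d)) {s : ℝ} (hs : 0 < s) (hs1 : s ≤ 1) :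
    Integrable fun y => mehler d m s x y * f y := by
  obtain ⟨C, hC, c, hc, hbound⟩ := exists_mehler_le_of_le_one hσ.1.le hm x
  have hmeas : Measurable fun y => mehler d m s x y :=
    (measurable_mehler d m x).comp (measurable_prodMk_left (x := s))
  refine (hfint.const_mul (C * s ^ (-(d : ℝ) / 2))).mono' (by fun_prop)
    (Eventually.of_forall fun y => ?_)
  have hPhi := PhiSigma_pos (m := m) (σ := σ) y
  have h2 : Real.exp (-(c * ‖x - y‖ ^ 2) / s) ≤ 1 := by
    rw [Real.exp_le_one_iff, neg_div]
    have : 0 ≤ c * ‖x - y‖ ^ 2 / s := by positivity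
    linarith
  rw [norm_mul, Real.norm_of_nonneg (mehler_nonneg hs.le x y), Real.norm_eq_abs]
  calc _ ≤ (C * s ^ (-(d : ℝ) / 2) * 1 * PhiSigma d m σ y) * |f y| := by
        gcongr
        refine (hbound s hs hs1 y).trans ?_
        gcongr
    _ = _ := by ring

theorem integrable_one_mul_PhiSigma (hσ : σ ∈ Ioo (0 : ℝ) 1) (hm : -(d : ℝ) ≤ m) (c : ℝ) :
    Integrable fun y : EuclideanSpace ℝ (Fin d) => |c| * PhiSigma d m σ y :=
  (integrable_PhiSigma hσ.1.le hm).const_mul _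

/-- The even part of the kernel against second differences, the odd part against first
differences. -/
theorem lintegral_symmetrized_near_le (hσ : σ ∈ Ioo (0 : ℝ) 1) (m : ℝ)
    (x : EuclideanSpace ℝ (Fin d)) :
    ∃ C > 0, ∀ h : EuclideanSpace ℝ (Fin d), ‖h‖ ≤ 1 → ∀ a b : ℝ, (h = 0 → a = 0 ∧ b = 0) →
      ∫⁻ s in Ioc (0 : ℝ) 1, ‖(mehler d m s x (x + h) * a + mehler d m s x (x + -h) * b) / 2 *
        s ^ (-(1 + σ))‖ₑ ≤ ENNReal.ofReal (C * (|a + b| / ‖h‖ ^ ((d : ℝ) + 2 * σ) +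
          |a - b| / ‖h‖ ^ max ((d : ℝ) + 2 * σ - 3) 0)) := by
  obtain ⟨C, hC, hbound⟩ := exists_mehler_near_le (d := d) m x
  obtain ⟨C', hC', hodd⟩ := exists_lintegral_rpow_mul_exp_neg_sq_le ((d : ℝ) + 2 * σ)
  have hp : 0 < (d : ℝ) / 2 + σ := by
    have := hσ.1
    positivity
  have hG := Real.Gamma_pos_of_pos hp
  set C₁ := C * (4 ^ ((d : ℝ) / 2 + σ) * Real.Gamma ((d : ℝ) / 2 + σ)) with hC₁
  set C₂ := C * C' with hC₂
  have hC₁0 : 0 < C₁ := by positivity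
  have hC₂0 : 0 < C₂ := by positivity
  refine ⟨C₁ + C₂, by positivity, fun h hh a b hab => ?_⟩
  rcases eq_or_ne h 0 with h0 | h0
  · obtain ⟨ha, hb⟩ := hab h0
    simp [ha, hb]
  have hr : 0 < ‖h‖ := norm_pos_iff.mpr h0
  set r := ‖h‖ with hrdef
  have hpt (s : ℝ) (hs : s ∈ Ioc (0 : ℝ) 1) :
      ‖(mehler d m s x (x + h) * a + mehler d m s x (x + -h) * b) / 2 * s ^ (-(1 + σ))‖ₑ ≤
        ENNReal.ofReal (C * |a + b|) *
          ENNReal.ofReal (s ^ (-1 - ((d : ℝ) / 2 + σ)) * Real.exp (-(r ^ 2 / 4) / s)) +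
        ENNReal.ofReal (C * |a - b|) *
          ENNReal.ofReal (r * s ^ (-(((d : ℝ) + 2 * σ) / 2)) * Real.exp (-(r ^ 2 / 4) / s)) := by
    have hs0 : 0 < s := hs.1
    rw [← ENNReal.ofReal_mul (by positivity), ← ENNReal.ofReal_mul (by positivity),
      ← ENNReal.ofReal_add (by positivity) (by positivity), Real.enorm_eq_ofReal_abs]
    refine ENNReal.ofReal_le_ofReal ?_
    obtain ⟨h1, h2⟩ := hbound s hs.1 hs.2 h hh
    obtain ⟨h3, -⟩ := hbound s hs.1 hs.2 (-h) (by rwa [norm_neg])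
    rw [norm_neg] at h3
    have hn1 := mehler_nonneg (m := m) hs0.le x (x + h)
    have hn3 := mehler_nonneg (m := m) hs0.le x (x + -h)
    set H := mehler d m s x (x + h)
    set H' := mehler d m s x (x + -h)
    set B := C * s ^ (-(d : ℝ) / 2) * Real.exp (-(r ^ 2 / 4) / s) with hB
    have hB0 : 0 ≤ B := by positivity
    have hmain : |(H * a + H' * b) / 2| ≤ B * |a + b| + B * (s * r) * |a - b| := by
      have e : (H * a + H' * b) / 2 = ((H + H') * (a + b) + (H - H') * (a - b)) / 4 := by ring
      rw [e, abs_div, abs_of_pos (show (0 : ℝ) < 4 by norm_num), div_le_iff₀ (by norm_num)]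
      calc |(H + H') * (a + b) + (H - H') * (a - b)|
          ≤ |(H + H') * (a + b)| + |(H - H') * (a - b)| := abs_add_le _ _
        _ = (H + H') * |a + b| + |H - H'| * |a - b| := by
            rw [abs_mul, abs_mul, abs_of_nonneg (by linarith)]
        _ ≤ (B + B) * |a + b| + (B * (s * r)) * |a - b| := by gcongr
        _ ≤ _ := by
            have h4 : 0 ≤ B * |a + b| := by positivity
            have h5 : 0 ≤ B * (s * r) * |a - b| := by positivity
            linarith
    rw [abs_mul, abs_of_nonneg (by positivity : 0 ≤ s ^ (-(1 + σ)))]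
    refine (mul_le_mul_of_nonneg_right hmain (by positivity)).trans_eq ?_
    have e1 : s ^ (-1 - ((d : ℝ) / 2 + σ)) = s ^ (-(d : ℝ) / 2) * s ^ (-(1 + σ)) := by
      rw [← Real.rpow_add hs0]; ring_nf
    have e2 : s ^ (-(((d : ℝ) + 2 * σ) / 2)) = s * (s ^ (-(d : ℝ) / 2) * s ^ (-(1 + σ))) := by
      rw [← Real.rpow_add hs0, mul_comm s, ← Real.rpow_add_one hs0.ne']; ring_nf
    rw [e1, e2, hB]
    ring
  have hmeas : Measurable fun s : ℝ => ENNReal.ofReal (C * |a + b|) *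
      ENNReal.ofReal (s ^ (-1 - ((d : ℝ) / 2 + σ)) * Real.exp (-(r ^ 2 / 4) / s)) := by fun_prop
  calc _ ≤ _ := setLIntegral_mono' measurableSet_Ioc hpt
    _ = ENNReal.ofReal (C * |a + b|) * (∫⁻ s in Ioc (0 : ℝ) 1,
          ENNReal.ofReal (s ^ (-1 - ((d : ℝ) / 2 + σ)) * Real.exp (-(r ^ 2 / 4) / s))) +
        ENNReal.ofReal (C * |a - b|) * ∫⁻ s in Ioc (0 : ℝ) 1,
          ENNReal.ofReal (r * s ^ (-(((d : ℝ) + 2 * σ) / 2)) * Real.exp (-(r ^ 2 / 4) / s)) := by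
        rw [lintegral_add_left hmeas, lintegral_const_mul' _ _ ENNReal.ofReal_ne_top,
          lintegral_const_mul' _ _ ENNReal.ofReal_ne_top]
    _ ≤ ENNReal.ofReal (C * |a + b|) *
          ENNReal.ofReal ((r ^ 2 / 4) ^ (-((d : ℝ) / 2 + σ)) * Real.Gamma ((d : ℝ) / 2 + σ)) +
        ENNReal.ofReal (C * |a - b|) *
          ENNReal.ofReal (C' / r ^ max ((d : ℝ) + 2 * σ - 3) 0) := by
        gcongr
        · refine (lintegral_mono_set Ioc_subset_Ioi_self).trans_eq ?_
          exact lintegral_rpow_mul_exp_neg_div hp (by positivity)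
        · exact hodd r hr
    _ ≤ _ := by
        rw [← ENNReal.ofReal_mul (by positivity), ← ENNReal.ofReal_mul (by positivity),
          ← ENNReal.ofReal_add (by positivity) (by positivity)]
        refine ENNReal.ofReal_le_ofReal ?_
        have e : (r ^ 2 / 4) ^ (-((d : ℝ) / 2 + σ)) =
            4 ^ ((d : ℝ) / 2 + σ) / r ^ ((d : ℝ) + 2 * σ) := by
          rw [Real.rpow_neg (by positivity), Real.div_rpow (by positivity) (by norm_num),
            ← Real.rpow_natCast, ← Real.rpow_mul hr.le, inv_div]
          push_cast
          ring_nf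
        rw [e]
        have q1 : 0 ≤ |a + b| / r ^ ((d : ℝ) + 2 * σ) := by positivity
        have q2 : 0 ≤ |a - b| / r ^ max ((d : ℝ) + 2 * σ - 3) 0 := by positivity
        calc _ = C₁ * (|a + b| / r ^ ((d : ℝ) + 2 * σ)) +
              C₂ * (|a - b| / r ^ max ((d : ℝ) + 2 * σ - 3) 0) := by
              rw [hC₁, hC₂]
              ring
          _ ≤ _ := by nlinarith

/-- Symmetrized form of the kernel acting on `f - f x`, integrable in space and small time. -/
theorem integrable_symmetrized_prod (hσ : σ ∈ Ioo (0 : ℝ) 1) (hm : -(d : ℝ) ≤ m)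
    (hf : Measurable f) (hfint : Integrable fun y => |f y| * PhiSigma d m σ y)
    (x : EuclideanSpace ℝ (Fin d)) (hsmooth : DalphaStAt d (2 * σ) f x) :
    Integrable (fun p : ℝ × EuclideanSpace ℝ (Fin d) =>
      (mehler d m p.1 x (x + p.2) * (f (x + p.2) - f x) +
        mehler d m p.1 x (x + -p.2) * (f (x + -p.2) - f x)) / 2 * p.1 ^ (-(1 + σ)))
      ((volume.restrict (Ioc 0 1)).prod volume) := by
  obtain ⟨⟨δ₁, hδ₁, hD₁⟩, δ₂, hδ₂, hD₂⟩ := hsmooth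
  set δ := min 1 (min δ₁ δ₂) with hδ
  have hδ0 : 0 < δ := lt_min one_pos (lt_min hδ₁ hδ₂)
  have hδ1 : δ ≤ 1 := min_le_left _ _
  obtain ⟨C₁, hC₁, hnear⟩ := lintegral_symmetrized_near_le (d := d) hσ m x
  obtain ⟨C₂, hC₂, hfar⟩ := exists_lintegral_mehler_small_le hσ hm x
    (show 0 < δ ^ 2 by positivity)
  set S : Set (EuclideanSpace ℝ (Fin d)) := {h | ‖h‖ ≤ δ} with hS
  have hSm : MeasurableSet S := (isClosed_le continuous_norm continuous_const).measurableSet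
  set g₁ : EuclideanSpace ℝ (Fin d) → ℝ := fun h => C₁ *
    (|f (x + h) + f (x - h) - 2 * f x| / ‖h‖ ^ ((d : ℝ) + 2 * σ) +
      |f (x + h) - f (x - h)| / ‖h‖ ^ max ((d : ℝ) + 2 * σ - 3) 0) with hg₁
  have hg₁i : IntegrableOn g₁ S := by
    refine Integrable.const_mul (Integrable.add ?_ ?_) C₁
    · exact hD₁.mono_set fun h (hh : ‖h‖ ≤ δ) =>
        hh.trans ((min_le_right _ _).trans (min_le_left _ _))
    · exact hD₂.mono_set fun h (hh : ‖h‖ ≤ δ) =>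
        hh.trans ((min_le_right _ _).trans (min_le_right _ _))
  set g₂ : EuclideanSpace ℝ (Fin d) → ℝ := fun y =>
    C₂ * (|f y| * PhiSigma d m σ y + |f x| * PhiSigma d m σ y) with hg₂
  have hg₂i : Integrable g₂ :=
    (hfint.add (integrable_one_mul_PhiSigma hσ hm (f x))).const_mul C₂
  have hg₂0 (y) : 0 ≤ g₂ y := by
    have := PhiSigma_pos (m := m) (σ := σ) y
    simp only [hg₂]
    positivity
  have hg₁0 (h) : 0 ≤ g₁ h := by
    simp only [hg₁]
    positivity
  have hgi : Integrable fun h => S.indicator g₁ h + (g₂ (x + h) + g₂ (x + -h)) := by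
    refine ((integrable_indicator_iff hSm).mpr hg₁i).add (Integrable.add ?_ ?_)
    · exact hg₂i.comp_add_left x
    · exact (hg₂i.comp_add_left x).comp_neg
  have hmeas := measurable_mehler d m x
  have hmeas₁ : Measurable fun p : ℝ × EuclideanSpace ℝ (Fin d) =>
      mehler d m p.1 x (x + p.2) :=
    hmeas.comp (g := fun q : ℝ × EuclideanSpace ℝ (Fin d) => mehler d m q.1 x q.2)
      (f := fun p : ℝ × EuclideanSpace ℝ (Fin d) => (p.1, x + p.2)) (by fun_prop)
  have hmeas₂ : Measurable fun p : ℝ × EuclideanSpace ℝ (Fin d) =>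
      mehler d m p.1 x (x + -p.2) :=
    hmeas.comp (g := fun q : ℝ × EuclideanSpace ℝ (Fin d) => mehler d m q.1 x q.2)
      (f := fun p : ℝ × EuclideanSpace ℝ (Fin d) => (p.1, x + -p.2)) (by fun_prop)
  refine integrable_prod_of_lintegral_le (by fun_prop) hgi fun h => ?_
  by_cases hh : h ∈ S
  · rw [indicator_of_mem hh]
    have hhδ : ‖h‖ ≤ δ := hh
    refine (hnear h (hhδ.trans hδ1) (f (x + h) - f x) (f (x + -h) - f x) ?_).trans
      (ENNReal.ofReal_le_ofReal ?_)
    · rintro rfl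
      simp
    · have e1 : f (x + h) - f x + (f (x + -h) - f x) = f (x + h) + f (x - h) - 2 * f x := by
        rw [← sub_eq_add_neg x h]; ring
      have e2 : f (x + h) - f x - (f (x + -h) - f x) = f (x + h) - f (x - h) := by
        rw [← sub_eq_add_neg x h]; ring
      rw [e1, e2]
      have := hg₂0 (x + h)
      have := hg₂0 (x + -h)
      simp only [hg₁]
      linarith
  · rw [indicator_of_notMem hh, zero_add]
    have hh' : δ < ‖h‖ := not_le.mp hh
    have hone (k : EuclideanSpace ℝ (Fin d)) (hk : δ < ‖k‖) :
        ∫⁻ s in Ioc (0 : ℝ) 1, ENNReal.ofReal (1 * mehler d m s x (x + k) * s ^ (-(1 + σ))) *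
          ENNReal.ofReal |f (x + k) - f x| ≤ ENNReal.ofReal (g₂ (x + k)) := by
      have hPhi := PhiSigma_pos (m := m) (σ := σ) (x + k)
      rw [lintegral_mul_const' _ _ ENNReal.ofReal_ne_top]
      calc _ ≤ ENNReal.ofReal (C₂ * PhiSigma d m σ (x + k)) *
            ENNReal.ofReal |f (x + k) - f x| := by
            gcongr
            refine hfar (x + k) (fun _ => 1) fun s _ _ => Or.inr ⟨?_, le_rfl⟩
            rw [sub_add_cancel_left, norm_neg]
            gcongr
        _ ≤ _ := by
            rw [← ENNReal.ofReal_mul (by positivity)]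
            refine ENNReal.ofReal_le_ofReal ?_
            calc _ ≤ C₂ * PhiSigma d m σ (x + k) * (|f (x + k)| + |f x|) := by
                  gcongr
                  exact abs_sub _ _
              _ = _ := by simp only [hg₂]; ring
    have hmk (k : EuclideanSpace ℝ (Fin d)) : Measurable fun s : ℝ => mehler d m s x k :=
      hmeas.comp (measurable_prodMk_right (y := k))
    calc _ ≤ ∫⁻ s in Ioc (0 : ℝ) 1,
          (ENNReal.ofReal (1 * mehler d m s x (x + h) * s ^ (-(1 + σ))) *
            ENNReal.ofReal |f (x + h) - f x| +
          ENNReal.ofReal (1 * mehler d m s x (x + -h) * s ^ (-(1 + σ))) *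
            ENNReal.ofReal |f (x + -h) - f x|) := by
          refine setLIntegral_mono' measurableSet_Ioc fun s hs => ?_
          have hs0 : 0 < s := hs.1
          have hn1 := mehler_nonneg (m := m) hs0.le x (x + h)
          have hn3 := mehler_nonneg (m := m) hs0.le x (x + -h)
          rw [← ENNReal.ofReal_mul (by positivity), ← ENNReal.ofReal_mul (by positivity),
            ← ENNReal.ofReal_add (by positivity) (by positivity), Real.enorm_eq_ofReal_abs]
          refine ENNReal.ofReal_le_ofReal ?_
          rw [abs_mul, abs_of_nonneg (by positivity : 0 ≤ s ^ (-(1 + σ)))]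
          set H := mehler d m s x (x + h)
          set H' := mehler d m s x (x + -h)
          have key : |(H * (f (x + h) - f x) + H' * (f (x + -h) - f x)) / 2| ≤
              H * |f (x + h) - f x| + H' * |f (x + -h) - f x| := by
            rw [abs_div, abs_two, div_le_iff₀ two_pos]
            refine (abs_add_le _ _).trans ?_
            rw [abs_mul, abs_mul, abs_of_nonneg hn1, abs_of_nonneg hn3]
            have h4 : 0 ≤ H * |f (x + h) - f x| := by positivity
            have h5 : 0 ≤ H' * |f (x + -h) - f x| := by positivity
            linarith
          refine (mul_le_mul_of_nonneg_right key (by positivity)).trans_eq ?_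
          ring
      _ = _ + _ := lintegral_add_left (by have := hmk (x + h); fun_prop) _
      _ ≤ ENNReal.ofReal (g₂ (x + h)) + ENNReal.ofReal (g₂ (x + -h)) :=
          add_le_add (hone h hh') (hone (-h) (by rwa [norm_neg]))
      _ = _ := (ENNReal.ofReal_add (hg₂0 _) (hg₂0 _)).symm

theorem integrableOn_heat_sub_small (hσ : σ ∈ Ioo (0 : ℝ) 1) (hm : -(d : ℝ) ≤ m)
    (hf : Measurable f) (hfint : Integrable fun y => |f y| * PhiSigma d m σ y)
    (x : EuclideanSpace ℝ (Fin d)) (hsmooth : DalphaStAt d (2 * σ) f x) :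
    IntegrableOn (fun s => ((∫ y, mehler d m s x y * f y) - f x) * s ^ (-(1 + σ)))
      (Ioc 0 1) := by
  have hsym := (integrable_symmetrized_prod hσ hm hf hfint x hsmooth).integral_prod_left
  have hmass : IntegrableOn (fun s => f x * ((∫ y, mehler d m s x y) - 1) * s ^ (-(1 + σ)))
      (Ioc 0 1) := by
    obtain ⟨C, hC⟩ := exists_integral_mehler_sub_one_le m x
    have hint : IntegrableOn (fun s : ℝ => |f x| * C * s ^ (-σ)) (Ioc 0 1) := by
      have := intervalIntegral.intervalIntegrable_rpow' (a := 0) (b := 1)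
        (show -1 < -σ by linarith [hσ.2])
      rw [intervalIntegrable_iff_integrableOn_Ioc_of_le zero_le_one] at this
      exact this.const_mul _
    have hmeas : Measurable fun s => ∫ y, mehler d m s x y :=
      ((measurable_mehler d m x).stronglyMeasurable.integral_prod_right' (ν := volume)).measurable
    refine hint.mono' (by fun_prop) ?_
    filter_upwards [ae_restrict_mem measurableSet_Ioc] with s hs
    have hs0 : 0 < s := hs.1
    rw [norm_mul, norm_mul, Real.norm_of_nonneg (by positivity : 0 ≤ s ^ (-(1 + σ))),
      Real.norm_eq_abs, Real.norm_eq_abs]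
    calc _ ≤ |f x| * (C * s) * s ^ (-(1 + σ)) := by
          have := hC s hs.1 hs.2
          gcongr
      _ = _ := by
          rw [show -σ = -(1 + σ) + 1 by ring, Real.rpow_add_one hs0.ne']
          ring
  refine (Integrable.add hsym hmass).congr ?_
  filter_upwards [ae_restrict_mem measurableSet_Ioc] with s hs
  have h1 := integrable_mehler_mul_small hσ hm hf hfint x hs.1 hs.2
  have h2 : Integrable fun y => mehler d m s x y * f x :=
    integrable_mehler_mul_small (f := fun _ => f x) hσ hm measurable_const
      (integrable_one_mul_PhiSigma hσ hm (f x)) x hs.1 hs.2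
  have h3 : Integrable fun y => mehler d m s x y * (f y - f x) :=
    (h1.sub h2).congr (Eventually.of_forall fun y => by simp only [Pi.sub_apply]; ring)
  have hval : ∫ y, mehler d m s x y * (f y - f x) =
      (∫ y, mehler d m s x y * f y) - (∫ y, mehler d m s x y) * f x := by
    rw [← integral_mul_const, ← integral_sub h1 h2]
    simp_rw [mul_sub]
  have h4 := h3.comp_add_left x
  have h5 := h4.comp_neg
  have hshift : ∫ h, (mehler d m s x (x + h) * (f (x + h) - f x) +
      mehler d m s x (x + -h) * (f (x + -h) - f x)) / 2 * s ^ (-(1 + σ)) =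
      (∫ y, mehler d m s x y * (f y - f x)) * s ^ (-(1 + σ)) := by
    rw [integral_mul_const, integral_div, integral_add h4 h5,
      integral_neg_eq_self (fun h => mehler d m s x (x + h) * (f (x + h) - f x)) volume,
      integral_add_left_eq_self (fun y => mehler d m s x y * (f y - f x)) x]
    ring
  simp only [Pi.add_apply]
  rw [hshift, hval]
  ring

theorem integrableOn_heat_sub (hσ : σ ∈ Ioo (0 : ℝ) 1) (hm : -(d : ℝ) ≤ m)
    (hf : Measurable f) (hfint : Integrable fun y => |f y| * PhiSigma d m σ y)
    (x : EuclideanSpace ℝ (Fin d)) (hsmooth : DalphaStAt d (2 * σ) f x) :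
    IntegrableOn (fun s => ((∫ y, mehler d m s x y * f y) - f x) * s ^ (-(1 + σ)))
      (Ioi 0) := by
  rw [← Ioc_union_Ioi_eq_Ioi (zero_le_one' ℝ), integrableOn_union]
  refine ⟨integrableOn_heat_sub_small hσ hm hf hfint x hsmooth, ?_⟩
  have h1 := (integrable_mehler_mul_prod_large hσ hm hf hfint x).integral_prod_left
  have h2 : IntegrableOn (fun s : ℝ => f x * s ^ (-(1 + σ))) (Ioi 1) :=
    (integrableOn_Ioi_rpow_of_lt (by linarith [hσ.1]) one_pos).const_mul _
  refine (Integrable.sub h1 h2).congr (Eventually.of_forall fun s => ?_)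
  simp only [Pi.sub_apply]
  rw [sub_mul, ← integral_mul_const]
  congr 2
  ext y
  ring

/-- The Poisson extension as a subordination integral of the heat semigroup. -/
theorem integral_hermitePoisson_eq (hσ : σ ∈ Ioo (0 : ℝ) 1) (hm : -(d : ℝ) ≤ m)
    (hf : Measurable f) (hfint : Integrable fun y => |f y| * PhiSigma d m σ y)
    (x : EuclideanSpace ℝ (Fin d)) (hsmooth : DalphaStAt d (2 * σ) f x) {t : ℝ} (ht : 0 < t) :
    ∫ y, hermitePoisson d m σ t x y * f y = f x + (t / 2) ^ (2 * σ) / Real.Gamma σ *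
      ∫ s in Ioi (0 : ℝ), Real.exp (-t ^ 2 / (4 * s)) *
        (((∫ y, mehler d m s x y * f y) - f x) * s ^ (-(1 + σ))) := by
  have hG := Real.Gamma_pos_of_pos hσ.1
  have hg := integrableOn_heat_sub hσ hm hf hfint x hsmooth
  set A := (t / 2) ^ (2 * σ) / Real.Gamma σ with hA
  have hprod := integrable_poisson_prod hσ hm hf hfint x ht
  have hswap : ∫ y, hermitePoisson d m σ t x y * f y = A * ∫ s in Ioi (0 : ℝ),
      ∫ y, Real.exp (-t ^ 2 / (4 * s)) * mehler d m s x y * s ^ (-(1 + σ)) * f y := by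
    rw [integral_integral_swap hprod, ← integral_const_mul]
    refine integral_congr_ae (Eventually.of_forall fun y => ?_)
    simp only [hermitePoisson]
    rw [mul_assoc, ← integral_mul_const]
  obtain ⟨hi, hv⟩ := integrableOn_rpow_mul_exp_neg_div hσ.1 (show 0 < t ^ 2 / 4 by positivity)
  have hgi : IntegrableOn (fun s => Real.exp (-t ^ 2 / (4 * s)) *
      (((∫ y, mehler d m s x y * f y) - f x) * s ^ (-(1 + σ)))) (Ioi 0) := by
    refine hg.norm.mono' (AEStronglyMeasurable.mul ?_ hg.aestronglyMeasurable) ?_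
    · have : Measurable fun s : ℝ => Real.exp (-t ^ 2 / (4 * s)) := by fun_prop
      exact this.aestronglyMeasurable
    · filter_upwards [ae_restrict_mem measurableSet_Ioi] with s hs
      have hs0 : 0 < s := hs
      rw [norm_mul, Real.norm_of_nonneg (Real.exp_pos _).le]
      refine mul_le_of_le_one_left (norm_nonneg _) ?_
      rw [Real.exp_le_one_iff, neg_div]
      have : 0 ≤ t ^ 2 / (4 * s) := by positivity
      linarith
  have hsplit : ∫ s in Ioi (0 : ℝ),
      ∫ y, Real.exp (-t ^ 2 / (4 * s)) * mehler d m s x y * s ^ (-(1 + σ)) * f y =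
      (∫ s in Ioi (0 : ℝ), Real.exp (-t ^ 2 / (4 * s)) *
        (((∫ y, mehler d m s x y * f y) - f x) * s ^ (-(1 + σ)))) +
      ∫ s in Ioi (0 : ℝ), f x * (s ^ (-1 - σ) * Real.exp (-(t ^ 2 / 4) / s)) := by
    rw [← integral_add hgi (hi.const_mul (f x))]
    refine setIntegral_congr_fun measurableSet_Ioi fun s hs => ?_
    have hs0 : 0 < s := hs
    have e1 : ∫ y, Real.exp (-t ^ 2 / (4 * s)) * mehler d m s x y * s ^ (-(1 + σ)) * f y =
        Real.exp (-t ^ 2 / (4 * s)) * s ^ (-(1 + σ)) * ∫ y, mehler d m s x y * f y := by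
      rw [← integral_const_mul]
      congr 1
      ext y
      ring
    have e2 : -(t ^ 2 / 4) / s = -t ^ 2 / (4 * s) := by field_simp
    beta_reduce
    rw [e1, e2, show -1 - σ = -(1 + σ) by ring]
    ring
  have hone : A * ((t ^ 2 / 4) ^ (-σ) * Real.Gamma σ) = 1 := by
    have e : (t ^ 2 / 4) ^ (-σ) = ((t / 2) ^ (2 * σ))⁻¹ := by
      rw [show t ^ 2 / 4 = (t / 2) ^ (2 : ℝ) by rw [Real.rpow_two]; ring,
        ← Real.rpow_mul (by positivity), mul_neg, Real.rpow_neg (by positivity)]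
    have : 0 < (t / 2) ^ (2 * σ) := by positivity
    rw [e, hA]
    field_simp
  rw [hswap, hsplit, integral_const_mul, hv]
  linear_combination f x * hone

end HeatSemigroup

/-- For the Hermite-type operator `L = -Δ + |x|² + m` with `d ≥ 1`,
`m ≥ -d`, `σ ∈ (0,1)`: if `f ∈ L¹(Φ_σ)` is measurable and strictly `2σ`-smooth at `x₀`,
then `t ↦ P^σ_t f(x₀)` is differentiable on `(0,∞)` and
`lim_{t→0⁺} (-c_σ t^{1-2σ} ∂_t P^σ_t f(x₀)) = (1/Γ(-σ)) ∫₀^∞ (e^{-sL}f(x₀) - f(x₀)) s^{-(1+σ)} ds`,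
where `c_σ = 2^{2σ-1} Γ(σ)/Γ(1-σ)` and `Γ(-σ) := Γ(1-σ)/(-σ)`. -/
theorem hermite_fractional_power_as_limit
    (d : ℕ) (hd : 1 ≤ d) (m : ℝ) (hm : -(d : ℝ) ≤ m)
    (σ : ℝ) (hσ : σ ∈ Set.Ioo (0 : ℝ) 1)
    (f : EuclideanSpace ℝ (Fin d) → ℝ) (hfmeas : Measurable f)
    (hfint : MeasureTheory.Integrable (fun y => |f y| * PhiSigma d m σ y))
    (x₀ : EuclideanSpace ℝ (Fin d))
    (hsmooth : DalphaStAt d (2 * σ) f x₀) :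
    (∀ t ∈ Set.Ioi (0 : ℝ),
      DifferentiableAt ℝ (fun u => ∫ y, hermitePoisson d m σ u x₀ y * f y) t) ∧
    Filter.Tendsto
      (fun t => -((2 : ℝ) ^ (2 * σ - 1) * Real.Gamma σ / Real.Gamma (1 - σ)) *
        t ^ (1 - 2 * σ) * deriv (fun u => ∫ y, hermitePoisson d m σ u x₀ y * f y) t)
      (nhdsWithin 0 (Set.Ioi 0))
      (nhds ((1 / (Real.Gamma (1 - σ) / (-σ))) *
        ∫ s in Set.Ioi (0 : ℝ), ((∫ y, mehler d m s x₀ y * f y) - f x₀) * s ^ (-(1 + σ)))) := by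
  have hG := Real.Gamma_pos_of_pos hσ.1
  have hG' := Real.Gamma_pos_of_pos (show 0 < 1 - σ by linarith [hσ.2])
  have hg := integrableOn_heat_sub hσ hm hfmeas hfint x₀ hsmooth
  set g : ℝ → ℝ := fun s => ((∫ y, mehler d m s x₀ y * f y) - f x₀) * s ^ (-(1 + σ)) with hgdef
  set Q : ℝ → ℝ := fun u => ∫ y, hermitePoisson d m σ u x₀ y * f y with hQ
  set G : ℝ → ℝ := fun u => ∫ s in Ioi (0 : ℝ), Real.exp (-u ^ 2 / (4 * s)) * g s with hGdef
  set G' : ℝ → ℝ := fun t => ∫ s in Ioi (0 : ℝ),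
    -(t / (2 * s)) * Real.exp (-t ^ 2 / (4 * s)) * g s with hG'def
  have hderiv (t : ℝ) (ht : 0 < t) : HasDerivAt Q
      (1 / 2 * (2 * σ) * (t / 2) ^ (2 * σ - 1) / Real.Gamma σ * G t +
        (t / 2) ^ (2 * σ) / Real.Gamma σ * G' t) t := by
    have h1 : HasDerivAt (fun u : ℝ => (u / 2) ^ (2 * σ) / Real.Gamma σ)
        (1 / 2 * (2 * σ) * (t / 2) ^ (2 * σ - 1) / Real.Gamma σ) t :=
      (((hasDerivAt_id' t).div_const 2).rpow_const (Or.inl (by positivity))).div_const _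
    have h2 := (h1.mul (hasDerivAt_integral_exp_neg_sq_div hg ht)).const_add (f x₀)
    refine h2.congr_of_eventuallyEq ?_
    filter_upwards [Ioi_mem_nhds ht] with u hu
    exact integral_hermitePoisson_eq hσ hm hfmeas hfint x₀ hsmooth hu
  refine ⟨fun t ht => (hderiv t ht).differentiableAt, ?_⟩
  have hlim : Tendsto (fun t => -(σ / Real.Gamma (1 - σ)) * G t +
      -(1 / (2 * Real.Gamma (1 - σ))) * (t * G' t)) (nhdsWithin 0 (Ioi 0))
      (nhds (-(σ / Real.Gamma (1 - σ)) * (∫ s in Ioi (0 : ℝ), g s) +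
        -(1 / (2 * Real.Gamma (1 - σ))) * 0)) :=
    ((tendsto_integral_exp_neg_sq_div hg).const_mul _).add
      ((tendsto_mul_integral_deriv_exp_neg_sq_div hg).const_mul _)
  have hval : -(σ / Real.Gamma (1 - σ)) * (∫ s in Ioi (0 : ℝ), g s) +
      -(1 / (2 * Real.Gamma (1 - σ))) * 0 =
      1 / (Real.Gamma (1 - σ) / (-σ)) * ∫ s in Ioi (0 : ℝ), g s := by
    rw [one_div_div, neg_div, mul_zero, add_zero]
  rw [hval] at hlim
  refine hlim.congr' ?_
  filter_upwards [self_mem_nhdsWithin] with t ht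
  have ht0 : 0 < t := ht
  rw [(hderiv t ht0).deriv]
  have e1 : (t / 2) ^ (2 * σ) = (t / 2) ^ (2 * σ - 1) * (t / 2) := by
    rw [← Real.rpow_add_one (by positivity), sub_add_cancel]
  have e2 : (2 : ℝ) ^ (2 * σ - 1) * t ^ (1 - 2 * σ) * (t / 2) ^ (2 * σ - 1) = 1 := by
    rw [Real.div_rpow ht0.le two_pos.le, show 1 - 2 * σ = -(2 * σ - 1) by ring,
      Real.rpow_neg ht0.le]
    have : 0 < t ^ (2 * σ - 1) := by positivity
    field_simp
  have e3 : -(2 ^ (2 * σ - 1) * Real.Gamma σ / Real.Gamma (1 - σ)) * t ^ (1 - 2 * σ) *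
      (1 / 2 * (2 * σ) * (t / 2) ^ (2 * σ - 1) / Real.Gamma σ * G t +
        (t / 2) ^ (2 * σ) / Real.Gamma σ * G' t) =
      (2 ^ (2 * σ - 1) * t ^ (1 - 2 * σ) * (t / 2) ^ (2 * σ - 1)) *
        (-(σ / Real.Gamma (1 - σ)) * G t + -(1 / (2 * Real.Gamma (1 - σ))) * (t * G' t)) := by
    rw [e1]
    field_simp
    ring
  rw [e3, e2, one_mul]
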